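/- arXiv:1711.10276 — 5 statements merged into one kernel-verified Lean document; each statement's English description precedes it below -/
import Mathlib

section
/- There is an ambient isotopy between the image of the Bézier curve β_0 and the closed piecewise linear curve K_{0,4} (obtained from K_0 by 4 iterations of de Casteljau subdivision at parameter 1/2); consequently, the image of β_0 is the unknot, i.e., there is an ambient isotopy between it and the round circle {(x,y,0) : x² + y² = 1}. -/
open Set Real

noncomputable section

/-- Points in ℝ³. -/
abbrev V3 : Type := Fin 3 → ℝ

/-- The point (x, y, z) ∈ ℝ³. -/
def pt (x y z : ℝ) : V3 := ![x, y, z]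

/-- Standard parameterization on `[0,1]` of the piecewise linear curve through
`P 0, P 1, …, P m`, traversing the `m` edges in order at constant speed. -/
def plPath (P : ℕ → V3) (m : ℕ) (t : ℝ) : V3 :=
  let s := t * m
  let i := ⌊s⌋.toNat
  (1 - (s - i)) • P i + (s - i) • P (i + 1)

/-- An ambient isotopy between subsets `X` and `Y` of ℝ³: a continuous map
`H : ℝ³ × [0,1] → ℝ³` with `H(·,0) = id`, each `H(·,t)` a homeomorphism of ℝ³
onto itself, and `H(X × {1}) = Y`. -/
def AmbientIsotopic (X Y : Set V3) : Prop :=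
  ∃ H : V3 → ℝ → V3,
    ContinuousOn (fun p : V3 × ℝ => H p.1 p.2) (univ ×ˢ Icc (0 : ℝ) 1) ∧
    (∀ x, H x 0 = x) ∧
    (∀ t ∈ Icc (0 : ℝ) 1, ∃ h : V3 ≃ₜ V3, ∀ x, H x t = h x) ∧
    (fun x => H x 1) '' X = Y

/-- The round circle {(x, y, 0) : x² + y² = 1}. -/
def unitCircle : Set V3 := {p : V3 | ∃ x y : ℝ, x ^ 2 + y ^ 2 = 1 ∧ p = pt x y 0}

/-- The standard trefoil, the image of
`t ↦ ((2 + cos 3t) cos 2t, (2 + cos 3t) sin 2t, sin 3t)` for `t ∈ [0, 2π]`. -/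
def trefoil : Set V3 :=
  {p : V3 | ∃ t ∈ Icc (0 : ℝ) (2 * π),
    p = pt ((2 + cos (3 * t)) * cos (2 * t)) ((2 + cos (3 * t)) * sin (2 * t)) (sin (3 * t))}

/-- Cyclic vertex function determined by a list of points. -/
def vertsOf (L : List V3) : ℕ → V3 := fun m => L.getD (m % L.length) 0

/-- The vertices of the closed PL curve K₀. -/
def K0verts : List V3 :=
  [pt 0 9 20, pt (-15) (-95) (-50), pt 40 80 (-20), pt (-10) (-60) 58,
   pt (-60) 30 20, pt 40 (-60) (-60)]

/-- The vertices of the closed PL curve K₁ (the vertex (−10,−60,58) of K₀ is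
replaced by (10,−60,58)). -/
def K1verts : List V3 :=
  [pt 0 9 20, pt (-15) (-95) (-50), pt 40 80 (-20), pt 10 (-60) 58,
   pt (-60) 30 20, pt 40 (-60) (-60)]

/-- The standard loop parameterization of K₀. -/
def K0loop : ℝ → V3 := plPath (vertsOf K0verts) 6

/-- The standard loop parameterization of K₁. -/
def K1loop : ℝ → V3 := plPath (vertsOf K1verts) 6

/-- The closed PL curve K₀ as a subset of ℝ³. -/
def K0 : Set V3 := K0loop '' Icc 0 1

/-- The closed PL curve K₁ as a subset of ℝ³. -/
def K1 : Set V3 := K1loop '' Icc 0 1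

/-- The de Casteljau points `P_i^{(k)}` at parameter 1/2:
`P_i^{(0)} = P_i` and `P_i^{(k)} = (P_i^{(k-1)} + P_{i+1}^{(k-1)})/2`. -/
def dcQ (P : ℕ → V3) : ℕ → ℕ → V3
  | 0, i => P i
  | k + 1, i => (1 / 2 : ℝ) • (dcQ P k i + dcQ P k (i + 1))

/-- Left half of one de Casteljau subdivision step at parameter 1/2:
`(P_0^{(0)}, P_0^{(1)}, …, P_0^{(n)})`. -/
def dcLeft (P : ℕ → V3) : ℕ → V3 := fun i => dcQ P i 0

/-- Right half of one de Casteljau subdivision step at parameter 1/2 on a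
degree-`n` control polygon: `(P_0^{(n)}, P_1^{(n-1)}, …, P_n^{(0)})`. -/
def dcRight (n : ℕ) (P : ℕ → V3) : ℕ → V3 := fun i => dcQ P (n - i) i

/-- The list of `2^k` sub-control polygons, in order, produced by `k` iterations
of de Casteljau subdivision at parameter 1/2 on a degree-`n` control polygon. -/
def subPolys (n : ℕ) : ℕ → (ℕ → V3) → List (ℕ → V3)
  | 0, P => [P]
  | k + 1, P => subPolys n k (dcLeft P) ++ subPolys n k (dcRight n P)

/-- Vertex function (cyclic) of the concatenation, in order, of a list of
degree-`n` control polygons whose consecutive endpoints agree. -/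
def concatVerts (n : ℕ) (L : List (ℕ → V3)) : ℕ → V3 :=
  fun m =>
    let m' := m % (n * L.length)
    (L.getD (m' / n) fun _ => 0) (m' % n)

/-- The standard loop parameterization of the closed PL curve obtained from the
degree-6 control polygon `Q` by `k` iterations of de Casteljau subdivision at
parameter 1/2 (concatenating the `2^k` sub-control polygons in order). -/
def Ksub (k : ℕ) (Q : ℕ → V3) : ℝ → V3 :=
  plPath (concatVerts 6 (subPolys 6 k Q)) (6 * 2 ^ k)

/-- The Bézier curve of degree `n` with control points `P 0, …, P n`. -/
def bezier (n : ℕ) (P : ℕ → V3) (t : ℝ) : V3 :=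
  ∑ i ∈ Finset.range (n + 1), ((n.choose i : ℝ) * t ^ i * (1 - t) ^ (n - i)) • P i

/-- The degree-6 Bézier curve β₀ whose control points are the listed vertices
of K₀ (with P₀ = P₆ = (0,9,20)). -/
def beta0 : ℝ → V3 := bezier 6 (vertsOf K0verts)

/-! ### Ambient isotopies and shears -/

theorem AmbientIsotopic.symm {X Y : Set V3} (h : AmbientIsotopic X Y) : AmbientIsotopic Y X := by
  obtain ⟨H, hc, h0, hh, rfl⟩ := h
  obtain ⟨e, he⟩ := hh 1 (by simp)
  refine ⟨fun x t => H (e.symm x) (1 - t), ?_, ?_, ?_, ?_⟩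
  · refine hc.comp (f := fun p : V3 × ℝ => (e.symm p.1, 1 - p.2)) (by fun_prop) ?_
    rintro ⟨x, t⟩ ⟨-, ht⟩
    simp only [mem_Icc] at ht
    exact ⟨mem_univ _, by simp only [mem_Icc]; constructor <;> linarith [ht.1, ht.2]⟩
  · intro x
    simp [he]
  · intro t ht
    obtain ⟨k, hk⟩ := hh (1 - t) ⟨by linarith [ht.2], by linarith [ht.1]⟩
    exact ⟨e.symm.trans k, fun x => by simp [hk]⟩
  · simp [image_image, h0, he]

theorem AmbientIsotopic.trans {X Y Z : Set V3} (h₁ : AmbientIsotopic X Y)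
    (h₂ : AmbientIsotopic Y Z) : AmbientIsotopic X Z := by
  obtain ⟨H, hc, h0, hh, rfl⟩ := h₁
  obtain ⟨G, gc, g0, gh, rfl⟩ := h₂
  refine ⟨fun x t => G (H x (min (2 * t) 1)) (max (2 * t - 1) 0), ?_, ?_, ?_, ?_⟩
  · refine gc.comp (f := fun p : V3 × ℝ => (H p.1 (min (2 * p.2) 1), max (2 * p.2 - 1) 0))
      (.prodMk ?_ (by fun_prop)) ?_
    · refine hc.comp (f := fun p : V3 × ℝ => (p.1, min (2 * p.2) 1)) (by fun_prop) ?_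
      rintro ⟨x, t⟩ ⟨-, ht⟩
      exact ⟨mem_univ _, le_min (by linarith [ht.1]) zero_le_one, min_le_right _ _⟩
    · rintro ⟨x, t⟩ ⟨-, ht⟩
      exact ⟨mem_univ _, le_max_right _ _, max_le (by linarith [ht.2]) zero_le_one⟩
  · intro x
    simp [h0, g0]
  · intro t ht
    obtain ⟨k, hk⟩ := hh (min (2 * t) 1) ⟨le_min (by linarith [ht.1]) zero_le_one, min_le_right _ _⟩
    obtain ⟨l, hl⟩ := gh (max (2 * t - 1) 0)
      ⟨le_max_right _ _, max_le (by linarith [ht.2]) zero_le_one⟩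
    exact ⟨k.trans l, fun x => by simp [hk, hl]⟩
  · have h1 : min (2 * (1 : ℝ)) 1 = 1 := by norm_num
    have h2 : max (2 * (1 : ℝ) - 1) 0 = 1 := by norm_num
    simp only [h1, h2, image_image]

/-- Adding to one coordinate a continuous function of the others is an ambient isotopy. -/
theorem ambientIsotopic_shear (k : Fin 3) (φ : V3 → ℝ) (hφ : Continuous φ)
    (hk : ∀ x c, φ (Function.update x k c) = φ x) (X : Set V3) :
    AmbientIsotopic X ((fun x => Function.update x k (x k + φ x)) '' X) := by
  refine ⟨fun x t => Function.update x k (x k + t * φ x), ?_, by simp, ?_, by simp⟩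
  · exact Continuous.continuousOn (by fun_prop)
  · intro t _
    exact ⟨{ toFun := fun x => Function.update x k (x k + t * φ x)
             invFun := fun x => Function.update x k (x k - t * φ x)
             left_inv := fun x => by simp [hk]
             right_inv := fun x => by simp [hk]
             continuous_toFun := by fun_prop
             continuous_invFun := by fun_prop }, fun x => rfl⟩

/-- One coordinate of a curve can be changed freely, as long as the change is a function of the
other two coordinates. -/
theorem ambientIsotopic_of_coordinate_change (k : Fin 3) {γ γ' : ℝ → V3}
    (hγ : ContinuousOn γ (Icc 0 1)) (hγ' : ContinuousOn γ' (Icc 0 1))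
    (hk : ∀ t ∈ Icc (0 : ℝ) 1, ∀ i, i ≠ k → γ' t i = γ t i)
    (hd : ∀ s ∈ Icc (0 : ℝ) 1, ∀ t ∈ Icc (0 : ℝ) 1, (∀ i, i ≠ k → γ s i = γ t i) →
      γ' s k - γ s k = γ' t k - γ t k) :
    AmbientIsotopic (γ '' Icc 0 1) (γ' '' Icc 0 1) := by
  let I : Set ℝ := Icc 0 1
  let ρ : V3 → V3 := fun x => Function.update x k 0
  have hρ : Continuous ρ := by fun_prop
  have hγr : Continuous (I.domRestrict γ) := hγ.domRestrict
  have hγr' : Continuous (I.domRestrict γ') := hγ'.domRestrict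
  have hq : Continuous (fun t : I => ρ (γ t)) := hρ.comp hγr
  let q : C(I, range fun t : I => ρ (γ t)) := ⟨rangeFactorization _, hq.subtype_mk _⟩
  have hqq : Topology.IsQuotientMap q :=
    Topology.IsQuotientMap.of_surjective_continuous rangeFactorization_surjective q.continuous
  let δ : C(I, ℝ) := ⟨fun t => γ' t k - γ t k,
    ((continuous_apply k).comp hγr').sub ((continuous_apply k).comp hγr)⟩
  have hlift : ∀ a b, q a = q b → δ a = δ b := by
    intro a b hab
    refine hd a a.2 b b.2 fun i hi => ?_
    have h1 : ρ (γ a) = ρ (γ b) := congrArg Subtype.val hab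
    simpa [ρ, hi] using congrFun h1 i
  let ψ : C(range fun t : I => ρ (γ t), ℝ) := hqq.lift δ hlift
  obtain ⟨Φ, hΦ⟩ := ContinuousMap.exists_restrict_eq (isCompact_range hq).isClosed ψ
  have key : ∀ t ∈ Icc (0 : ℝ) 1, Φ (ρ (γ t)) = γ' t k - γ t k := by
    intro t ht
    have h1 := DFunLike.congr_fun hΦ (q ⟨t, ht⟩)
    have h2 : ψ (q ⟨t, ht⟩) = δ ⟨t, ht⟩ := DFunLike.congr_fun (hqq.lift_comp δ hlift) ⟨t, ht⟩
    exact h1.trans h2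
  have := ambientIsotopic_shear k (fun x => Φ (ρ x)) (by fun_prop) (by simp [ρ]) (γ '' Icc 0 1)
  convert this using 1
  rw [image_image]
  refine image_congr fun t ht => ?_
  rw [key t ht]
  ext i
  by_cases hi : i = k
  · subst hi; simp
  · simp [hi, hk t ht i hi]

/-! ### Unknotting a curve with an embedded planar projection -/

theorem eq_or_eq_one_sub_of_cos_eq {s t : ℝ} (hs : s ∈ Icc (0 : ℝ) 1) (ht : t ∈ Icc (0 : ℝ) 1)
    (h : cos (2 * π * s) = cos (2 * π * t)) : s = t ∨ s = 1 - t := by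
  have aux : ∀ u ∈ Icc (0 : ℝ) 1, ∃ v ∈ Icc (0 : ℝ) (1 / 2),
      cos (2 * π * u) = cos (2 * π * v) ∧ (u = v ∨ u = 1 - v) := by
    intro u hu
    rcases le_total u (1 / 2) with h' | h'
    · exact ⟨u, ⟨hu.1, h'⟩, rfl, .inl rfl⟩
    · refine ⟨1 - u, ⟨by linarith [hu.2], by linarith⟩, ?_, .inr (by ring)⟩
      rw [← cos_two_pi_sub]
      ring_nf
  obtain ⟨v, hv, hsv, hv'⟩ := aux s hs
  obtain ⟨w, hw, htw, hw'⟩ := aux t ht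
  have hvw : 2 * π * v = 2 * π * w := by
    refine injOn_cos ?_ ?_ (hsv.symm.trans (h.trans htw))
    · exact ⟨by have := hv.1; positivity, by nlinarith [pi_pos, hv.2]⟩
    · exact ⟨by have := hw.1; positivity, by nlinarith [pi_pos, hw.2]⟩
  have : v = w := mul_left_cancel₀ (by positivity) hvw
  grind

theorem exists_cos_sin_eq {x y : ℝ} (h : x ^ 2 + y ^ 2 = 1) :
    ∃ t ∈ Icc (0 : ℝ) 1, cos (2 * π * t) = x ∧ sin (2 * π * t) = y := by
  have hx : -1 ≤ x ∧ x ≤ 1 := by constructor <;> nlinarith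
  have hπ : 0 < 2 * π := by positivity
  have h0 := arccos_nonneg x
  have h1 := arccos_le_pi x
  have hsq : 1 - x ^ 2 = y ^ 2 := by linarith
  rcases le_total 0 y with hy | hy
  · refine ⟨arccos x / (2 * π), ⟨by positivity, by rw [div_le_one hπ]; linarith⟩, ?_⟩
    rw [mul_div_cancel₀ _ hπ.ne', cos_arccos hx.1 hx.2, sin_arccos, hsq, sqrt_sq hy]
    simp
  · refine ⟨1 - arccos x / (2 * π), ⟨?_, ?_⟩, ?_⟩
    · rw [sub_nonneg, div_le_one hπ]; linarith
    · linarith [div_nonneg h0 hπ.le]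
    · have : 2 * π * (1 - arccos x / (2 * π)) = 2 * π - arccos x := by field_simp
      rw [this, cos_two_pi_sub, sin_two_pi_sub, cos_arccos hx.1 hx.2, sin_arccos, hsq,
        sqrt_sq_eq_abs, abs_of_nonpos hy]
      simp

@[simp] theorem pt_zero (x y z : ℝ) : pt x y z 0 = x := rfl

@[simp] theorem pt_one (x y z : ℝ) : pt x y z 1 = y := rfl

@[simp] theorem pt_two (x y z : ℝ) : pt x y z 2 = z := rfl

/-- A closed curve whose projection to the last two coordinates is embedded and whose points with
parameters `t` and `1 - t` have distinct heights is unknotted. -/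
theorem ambientIsotopic_unitCircle {γ : ℝ → V3} (hγ : ContinuousOn γ (Icc 0 1)) (h01 : γ 0 = γ 1)
    (hinj : ∀ s ∈ Ico (0 : ℝ) 1, ∀ t ∈ Ico (0 : ℝ) 1, γ s 1 = γ t 1 → γ s 2 = γ t 2 → s = t)
    (hne : ∀ t ∈ Ioo (0 : ℝ) (1 / 2), γ t 2 ≠ γ (1 - t) 2) :
    AmbientIsotopic (γ '' Icc 0 1) unitCircle := by
  have hcoord : ∀ i, ContinuousOn (fun t => γ t i) (Icc 0 1) := fun i =>
    (continuous_apply i).comp_continuousOn hγ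
  have hc : ContinuousOn (fun t => cos (2 * π * t)) (Icc 0 1) := by fun_prop
  have hs : ContinuousOn (fun t => sin (2 * π * t)) (Icc 0 1) := by fun_prop
  let γ₁ : ℝ → V3 := fun t => pt (cos (2 * π * t)) (γ t 1) (γ t 2)
  let γ₂ : ℝ → V3 := fun t => pt (cos (2 * π * t)) (sin (2 * π * t)) (γ t 2)
  let γ₃ : ℝ → V3 := fun t => pt (cos (2 * π * t)) (sin (2 * π * t)) 0
  have hpt : ∀ {f g h : ℝ → ℝ}, ContinuousOn f (Icc 0 1) → ContinuousOn g (Icc 0 1) →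
      ContinuousOn h (Icc 0 1) → ContinuousOn (fun t => pt (f t) (g t) (h t)) (Icc 0 1) := by
    intro f g h hf hg hh
    refine continuousOn_pi.2 fun i => ?_
    fin_cases i
    exacts [hf, hg, hh]
  have h₁ : ContinuousOn γ₁ (Icc 0 1) := hpt hc (hcoord 1) (hcoord 2)
  have h₂ : ContinuousOn γ₂ (Icc 0 1) := hpt hc hs (hcoord 2)
  have h₃ : ContinuousOn γ₃ (Icc 0 1) := hpt hc hs continuousOn_const
  have hends : ∀ s ∈ Icc (0 : ℝ) 1, ∃ s' ∈ Ico (0 : ℝ) 1, γ s = γ s' ∧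
      cos (2 * π * s) = cos (2 * π * s') ∧ sin (2 * π * s) = sin (2 * π * s') := by
    intro s hs
    rcases eq_or_lt_of_le hs.2 with rfl | h
    · exact ⟨0, by simp, h01.symm, by simp, by simp⟩
    · exact ⟨s, ⟨hs.1, h⟩, rfl, rfl, rfl⟩
  have step₁ : AmbientIsotopic (γ '' Icc 0 1) (γ₁ '' Icc 0 1) := by
    refine ambientIsotopic_of_coordinate_change 0 hγ h₁ ?_ ?_
    · intro t _ i hi
      fin_cases i
      exacts [absurd rfl hi, rfl, rfl]
    · intro s hs t ht h
      obtain ⟨s', hs', e₁, e₂, -⟩ := hends s hs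
      obtain ⟨t', ht', e₃, e₄, -⟩ := hends t ht
      have h' := hinj s' hs' t' ht' (by simpa [e₁, e₃] using h 1 (by decide))
        (by simpa [e₁, e₃] using h 2 (by decide))
      simp [γ₁, e₁, e₂, e₃, e₄, h']
  have step₂ : AmbientIsotopic (γ₁ '' Icc 0 1) (γ₂ '' Icc 0 1) := by
    refine ambientIsotopic_of_coordinate_change 1 h₁ h₂ ?_ ?_
    · intro t _ i hi
      fin_cases i
      exacts [rfl, absurd rfl hi, rfl]
    · intro s hs t ht h
      have hcos : cos (2 * π * s) = cos (2 * π * t) := by simpa [γ₁] using h 0 (by decide)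
      have hz : γ s 2 = γ t 2 := by simpa [γ₁] using h 2 (by decide)
      rcases eq_or_eq_one_sub_of_cos_eq hs ht hcos with rfl | rfl
      · rfl
      · rcases eq_or_lt_of_le ht.1 with rfl | ht0
        · simp [γ₁, γ₂, h01]
        rcases eq_or_lt_of_le ht.2 with rfl | ht1
        · simp [γ₁, γ₂, h01]
        rcases lt_trichotomy t (1 / 2) with h' | rfl | h'
        · exact absurd hz.symm (hne t ⟨ht0, h'⟩)
        · norm_num
        · exact absurd (by simpa using hz) (hne (1 - t) ⟨by linarith, by linarith⟩)
  have step₃ : AmbientIsotopic (γ₂ '' Icc 0 1) (γ₃ '' Icc 0 1) := by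
    refine ambientIsotopic_of_coordinate_change 2 h₂ h₃ ?_ ?_
    · intro t _ i hi
      fin_cases i
      exacts [rfl, rfl, absurd rfl hi]
    · intro s hs t ht h
      have hcos : cos (2 * π * s) = cos (2 * π * t) := by simpa [γ₂] using h 0 (by decide)
      have hsin : sin (2 * π * s) = sin (2 * π * t) := by simpa [γ₂] using h 1 (by decide)
      rcases eq_or_eq_one_sub_of_cos_eq hs ht hcos with rfl | rfl
      · rfl
      · have h0 : sin (2 * π * t) = 0 := by
          have : sin (2 * π * (1 - t)) = -sin (2 * π * t) := by
            rw [← sin_two_pi_sub]; ring_nf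
          linarith
        rcases eq_or_lt_of_le ht.1 with rfl | ht0
        · simp [γ₂, γ₃, h01]
        rcases eq_or_lt_of_le ht.2 with rfl | ht1
        · simp [γ₂, γ₃, h01]
        rcases lt_trichotomy t (1 / 2) with h' | rfl | h'
        · exact absurd h0 (sin_pos_of_pos_of_lt_pi (by positivity) (by nlinarith [pi_pos])).ne'
        · norm_num
        · have : 0 < sin (2 * π * (1 - t)) :=
            sin_pos_of_pos_of_lt_pi (by nlinarith [pi_pos]) (by nlinarith [pi_pos])
          rw [hsin, h0] at this
          exact absurd this (lt_irrefl 0)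
  convert (step₁.trans step₂).trans step₃ using 1
  ext p
  constructor
  · rintro ⟨x, y, h, rfl⟩
    obtain ⟨t, ht, rfl, rfl⟩ := exists_cos_sin_eq h
    exact ⟨t, ht, rfl⟩
  · rintro ⟨t, -, rfl⟩
    exact ⟨_, _, cos_sq_add_sin_sq _, rfl⟩

/-- A criterion for unknottedness in terms of the projection of a curve in the direction
`(20, 10, -3)`. -/
theorem ambientIsotopic_unitCircle_of_projection {γ : ℝ → V3} (hγ : ContinuousOn γ (Icc 0 1))
    (h01 : γ 0 = γ 1)
    (hinj : ∀ s ∈ Ico (0 : ℝ) 1, ∀ t ∈ Ico (0 : ℝ) 1, γ s 1 - γ s 0 / 2 = γ t 1 - γ t 0 / 2 →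
      γ s 2 + γ s 0 * (3 / 20) = γ t 2 + γ t 0 * (3 / 20) → s = t)
    (hne : ∀ t ∈ Ioo (0 : ℝ) (1 / 2), γ t 2 + γ t 1 - γ t 0 * (7 / 20) ≠
      γ (1 - t) 2 + γ (1 - t) 1 - γ (1 - t) 0 * (7 / 20)) :
    AmbientIsotopic (γ '' Icc 0 1) unitCircle := by
  let F : V3 → V3 := fun x => Function.update x 2 (x 2 + (x 1 - x 0 * (7 / 20)))
  let G : V3 → V3 := fun x => Function.update x 1 (x 1 + -(x 0 / 2))
  have hF : Continuous F := by fun_prop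
  have hG : Continuous G := by fun_prop
  have h1 : AmbientIsotopic (γ '' Icc 0 1) (F '' (γ '' Icc 0 1)) :=
    ambientIsotopic_shear 2 (fun x => x 1 - x 0 * (7 / 20)) (by fun_prop) (by simp) _
  have h2 : AmbientIsotopic (F '' (γ '' Icc 0 1)) (G '' (F '' (γ '' Icc 0 1))) :=
    ambientIsotopic_shear 1 (fun x => -(x 0 / 2)) (by fun_prop) (by simp) _
  refine (h1.trans h2).trans ?_
  rw [image_image, image_image]
  refine ambientIsotopic_unitCircle (by fun_prop) (by simp [h01]) ?_ ?_
  · intro s hs t ht e1 e2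
    simp only [F, G, Function.update_self, ne_eq, Fin.reduceEq, not_false_eq_true,
      Function.update_of_ne] at e1 e2
    exact hinj s hs t ht (by linarith) (by linarith)
  · intro t ht e
    simp only [F, G, Function.update_self, ne_eq, Fin.reduceEq, not_false_eq_true,
      Function.update_of_ne] at e
    exact hne t ht (by linarith)

/-! ### Scalar Bézier functions and embeddedness certificates -/

/-- The value at `s` of the Bézier function of degree `n` with coefficients `p 0, …, p n`. -/
def casteljau : ℕ → (ℕ → ℝ) → ℝ → ℝ
  | 0, p, _ => p 0
  | n + 1, p, s => (1 - s) * casteljau n p s + s * casteljau n (fun i => p (i + 1)) s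

theorem casteljau_neg (n : ℕ) (p : ℕ → ℝ) (s : ℝ) :
    casteljau n (fun i => -p i) s = -casteljau n p s := by
  induction n generalizing p with
  | zero => rfl
  | succ n ih => simp only [casteljau, ih]; ring

theorem casteljau_le {n : ℕ} {p : ℕ → ℝ} {r s : ℝ} (hs : s ∈ Icc (0 : ℝ) 1)
    (h : ∀ i ≤ n, p i ≤ r) : casteljau n p s ≤ r := by
  induction n generalizing p with
  | zero => exact h 0 le_rfl
  | succ n ih =>
    have h1 := ih fun i hi => h i (by omega)
    have h2 := ih (p := fun i => p (i + 1)) fun i hi => h (i + 1) (by omega)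
    simp only [casteljau]
    nlinarith [hs.1, hs.2]

theorem casteljau_lt {n : ℕ} {p : ℕ → ℝ} {r s : ℝ} (hs : s ∈ Icc (0 : ℝ) 1)
    (h : ∀ i ≤ n, p i < r) : casteljau n p s < r := by
  induction n generalizing p with
  | zero => exact h 0 le_rfl
  | succ n ih =>
    have h1 := ih fun i hi => h i (by omega)
    have h2 := ih (p := fun i => p (i + 1)) fun i hi => h (i + 1) (by omega)
    simp only [casteljau]
    rcases eq_or_lt_of_le hs.1 with rfl | h0
    · simpa using h1
    · nlinarith [hs.2]

theorem casteljau_lt_of_ne_last {n : ℕ} (hn : 0 < n) {p : ℕ → ℝ} {r s : ℝ}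
    (hs : s ∈ Ico (0 : ℝ) 1) (h : ∀ i < n, p i < r) (h' : p n ≤ r) : casteljau n p s < r := by
  obtain ⟨n, rfl⟩ : ∃ m, n = m + 1 := ⟨n - 1, by omega⟩
  have hs' : s ∈ Icc (0 : ℝ) 1 := ⟨hs.1, hs.2.le⟩
  have h1 : casteljau n p s < r := casteljau_lt hs' fun i hi => h i (by omega)
  have h2 : casteljau n (fun i => p (i + 1)) s ≤ r := casteljau_le hs' fun i hi => by
    rcases Nat.lt_or_ge (i + 1) (n + 1) with h'' | h''
    · exact (h _ h'').le
    · obtain rfl : i = n := by omega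
      exact h'
  simp only [casteljau]
  nlinarith [hs.1, hs.2]

theorem lt_casteljau {n : ℕ} {p : ℕ → ℝ} {r s : ℝ} (hs : s ∈ Icc (0 : ℝ) 1)
    (h : ∀ i ≤ n, r < p i) : r < casteljau n p s := by
  have := casteljau_lt (p := fun i => -p i) (r := -r) hs fun i hi => neg_lt_neg (h i hi)
  rw [casteljau_neg] at this
  linarith

theorem casteljau_lt_casteljau {n : ℕ} {p q : ℕ → ℝ} {s : ℝ} (hs : s ∈ Icc (0 : ℝ) 1)
    (h : ∀ i ≤ n, p i < q i) : casteljau n p s < casteljau n q s := by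
  induction n generalizing p q with
  | zero => exact h 0 le_rfl
  | succ n ih =>
    have h1 := ih fun i hi => h i (by omega)
    have h2 := ih (p := fun i => p (i + 1)) (q := fun i => q (i + 1))
      fun i hi => h (i + 1) (by omega)
    simp only [casteljau]
    rcases eq_or_lt_of_le hs.1 with rfl | h0
    · simpa using h1
    · nlinarith [hs.2]

theorem casteljau_monotoneOn {n : ℕ} {p : ℕ → ℝ} (h : ∀ i < n, p i < p (i + 1)) :
    MonotoneOn (casteljau n p) (Icc 0 1) := by
  induction n generalizing p with
  | zero => exact fun _ _ _ _ _ => le_rfl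
  | succ n ih =>
    intro s hs t ht hst
    have h1 := ih (p := p) (fun i hi => h i (by omega)) hs ht hst
    have h2 := ih (p := fun i => p (i + 1)) (fun i hi => h (i + 1) (by omega)) hs ht hst
    have h3 := casteljau_lt_casteljau (n := n) (p := p) (q := fun i => p (i + 1)) hs
      fun i hi => h i (by omega)
    simp only [casteljau]
    nlinarith [ht.1, ht.2]

theorem casteljau_strictMonoOn {n : ℕ} (hn : 0 < n) {p : ℕ → ℝ} (h : ∀ i < n, p i < p (i + 1)) :
    StrictMonoOn (casteljau n p) (Icc 0 1) := by
  obtain ⟨n, rfl⟩ : ∃ m, n = m + 1 := ⟨n - 1, by omega⟩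
  intro s hs t ht hst
  have h1 := casteljau_monotoneOn (n := n) (p := p) (fun i hi => h i (by omega)) hs ht hst.le
  have h2 := casteljau_monotoneOn (n := n) (p := fun i => p (i + 1))
    (fun i hi => h (i + 1) (by omega)) hs ht hst.le
  have h3 := casteljau_lt_casteljau (n := n) (p := p) (q := fun i => p (i + 1)) hs
    fun i hi => h i (by omega)
  simp only [casteljau]
  nlinarith [ht.1, ht.2]

/-- The real coefficient sequence of a list of integers. -/
def coeffs (l : List ℤ) : ℕ → ℝ := fun i => (l.getD i 0 : ℤ)

/-- All coefficients of `p`, except possibly the last one, are less than all coefficients of `q`,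
and the last one is at most all coefficients of `q`. -/
def separated (p q : List ℤ) : Bool :=
  q.all fun b => p.dropLast.all (fun a => decide (a < b)) && decide (p.getLastD 0 ≤ b)

/-- Two pieces of a curve, given by their coefficients in several directions, are separated in
one of these directions. -/
def apart (x y : List (List ℤ)) : Bool :=
  (x.zip y).any fun pq => separated pq.1 pq.2 || separated pq.2 pq.1

/-- The list is strictly increasing. -/
def increasing : List ℤ → Bool
  | a :: b :: l => decide (a < b) && increasing (b :: l)
  | _ => true

/-- Any two members of the list at distinct positions are apart. -/
def pairwiseApart : List (List (List ℤ)) → Bool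
  | x :: l => l.all (apart x) && pairwiseApart l
  | [] => true

/-- The pieces `D` of a curve, given by coefficients of degree `n` in `m` directions, are each
monotone in one of these directions, and any two of them are apart. -/
def certifies (m n : ℕ) (D : List (List (List ℤ))) : Bool :=
  D.all (fun x => decide (x.length = m) && x.all (fun l => decide (l.length = n + 1)) &&
    x.any increasing) && pairwiseApart D

theorem increasing_iff (l : List ℤ) : increasing l = true ↔ l.IsChain (· < ·) := by
  induction l with
  | nil => simp [increasing]
  | cons a l ih =>
    cases l with
    | nil => simp [increasing]
    | cons b l => simp [increasing, ih]

theorem pairwiseApart_iff (D : List (List (List ℤ))) :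
    pairwiseApart D = true ↔ D.Pairwise fun x y => apart x y = true := by
  induction D with
  | nil => simp [pairwiseApart]
  | cons x l ih => simp [pairwiseApart, ih]

theorem casteljau_lt_of_separated {n : ℕ} (hn : 0 < n) {p q : List ℤ} (hp : p.length = n + 1)
    (hq : q.length = n + 1) (h : separated p q = true) {s t : ℝ} (hs : s ∈ Ico (0 : ℝ) 1)
    (ht : t ∈ Ico (0 : ℝ) 1) : casteljau n (coeffs p) s < casteljau n (coeffs q) t := by
  simp only [separated, List.all_eq_true, Bool.and_eq_true, decide_eq_true_eq] at h
  refine lt_casteljau ⟨ht.1, ht.2.le⟩ fun k hk => ?_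
  have hqk : q.getD k 0 ∈ q := by
    rw [List.getD_eq_getElem _ _ (by omega)]
    exact List.getElem_mem _
  obtain ⟨h1, h2⟩ := h _ hqk
  refine casteljau_lt_of_ne_last hn hs (fun i hi => ?_) ?_
  · have : p.getD i 0 ∈ p.dropLast := by
      rw [List.getD_eq_getElem _ _ (by omega), ← List.getElem_dropLast (by simp; omega)]
      exact List.getElem_mem _
    exact Int.cast_lt.2 (h1 _ this)
  · have : p.getD n 0 = p.getLastD 0 := by
      rw [List.getLastD_eq_getLast?, List.getLast?_eq_getElem?, hp]
      simp [List.getD_eq_getElem?_getD]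
    exact Int.cast_le.2 (this ▸ h2)

theorem injective_of_certifies {m n N : ℕ} (hn : 0 < n) (hN₀ : 0 < N) {D : List (List (List ℤ))}
    (hD : D.length = N) (hc : certifies m n D = true) {h : ℕ → ℝ → ℝ}
    (hp : ∀ j < N, ∀ u < m, ∀ s ∈ Ico (0 : ℝ) 1,
      h u ((j + s) / N) = casteljau n (coeffs ((D.getD j []).getD u [])) s)
    {s t : ℝ} (hs : s ∈ Ico (0 : ℝ) 1) (ht : t ∈ Ico (0 : ℝ) 1) (hst : ∀ u < m, h u s = h u t) :
    s = t := by
  simp only [certifies, Bool.and_eq_true, List.all_eq_true, List.any_eq_true,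
    decide_eq_true_eq, pairwiseApart_iff, increasing_iff] at hc
  obtain ⟨hc, hpw⟩ := hc
  have hN : (0 : ℝ) < N := Nat.cast_pos.2 hN₀
  have split : ∀ s ∈ Ico (0 : ℝ) 1, ∃ j < N, ∃ s' ∈ Ico (0 : ℝ) 1, s = (j + s') / N := by
    intro s hs
    have h0 : 0 ≤ s * N := mul_nonneg hs.1 hN.le
    have h1 : s * N < N := by nlinarith [hs.2]
    refine ⟨⌊s * N⌋₊, (Nat.floor_lt h0).2 h1, s * N - ⌊s * N⌋₊,
      ⟨sub_nonneg.2 (Nat.floor_le h0), by linarith [Nat.lt_floor_add_one (s * N)]⟩, ?_⟩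
    field_simp
    ring
  have hlt : ∀ i j, i < j → j < N → ∀ a ∈ Ico (0 : ℝ) 1, ∀ b ∈ Ico (0 : ℝ) 1,
      ∃ u < m, h u ((i + a) / N) ≠ h u ((j + b) / N) := by
    intro i j hij hj a ha b hb
    have hi : i < D.length := by omega
    have hj' : j < D.length := by omega
    have hap := List.pairwise_iff_getElem.1 hpw i j hi hj' hij
    simp only [apart, List.any_eq_true, Bool.or_eq_true] at hap
    obtain ⟨pq, hmem, hsep⟩ := hap
    obtain ⟨u, hu, rfl⟩ := List.getElem_of_mem hmem
    simp only [List.length_zip, lt_inf_iff] at hu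
    simp only [List.getElem_zip] at hsep
    obtain ⟨⟨li, hi1⟩, -⟩ := hc _ (List.getElem_mem hi)
    obtain ⟨⟨lj, hj1⟩, -⟩ := hc _ (List.getElem_mem hj')
    refine ⟨u, by omega, ?_⟩
    rw [hp i (by omega) u (by omega) a ha, hp j hj u (by omega) b hb,
      List.getD_eq_getElem _ _ hi, List.getD_eq_getElem _ _ hj',
      List.getD_eq_getElem _ _ hu.1, List.getD_eq_getElem _ _ hu.2]
    have e1 := hi1 _ (List.getElem_mem hu.1)
    have e2 := hj1 _ (List.getElem_mem hu.2)
    rcases hsep with hsep | hsep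
    · exact (casteljau_lt_of_separated hn e1 e2 hsep ha hb).ne
    · exact (casteljau_lt_of_separated hn e2 e1 hsep hb ha).ne'
  obtain ⟨i, hi, a, ha, rfl⟩ := split s hs
  obtain ⟨j, hj, b, hb, rfl⟩ := split t ht
  rcases lt_trichotomy i j with hij | rfl | hij
  · obtain ⟨u, hu, h'⟩ := hlt i j hij hj a ha b hb
    exact absurd (hst u hu) h'
  · have hi' : i < D.length := by omega
    obtain ⟨⟨li, hi1⟩, l, hl, hinc⟩ := hc _ (List.getElem_mem hi')
    obtain ⟨u, hu, rfl⟩ := List.getElem_of_mem hl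
    have e1 := hi1 _ hl
    have key := hst u (by omega)
    rw [hp i hi u (by omega) a ha, hp i hi u (by omega) b hb, List.getD_eq_getElem _ _ hi',
      List.getD_eq_getElem _ _ hu] at key
    have hmono : StrictMonoOn (casteljau n (coeffs D[i][u])) (Icc 0 1) := by
      refine casteljau_strictMonoOn hn fun k hk => ?_
      simp only [coeffs]
      rw [List.getD_eq_getElem _ _ (by omega), List.getD_eq_getElem _ _ (by omega)]
      exact Int.cast_lt.2 (List.isChain_iff_getElem.1 hinc k (by omega))
    rw [hmono.injOn ⟨ha.1, ha.2.le⟩ ⟨hb.1, hb.2.le⟩ key]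
  · obtain ⟨u, hu, h'⟩ := hlt j i hij hi b hb a ha
    exact absurd (hst u hu).symm h'

/-! ### Integer subdivision -/

/-- Integer version of the left half of a subdivision step in degree 6, scaled by `2 ^ 6`. -/
def leftCoeffs : List ℤ → List ℤ
  | [a, b, c, d, e, f, g] =>
    [64 * a, 32 * (a + b), 16 * (a + 2 * b + c), 8 * (a + 3 * b + 3 * c + d),
      4 * (a + 4 * b + 6 * c + 4 * d + e), 2 * (a + 5 * b + 10 * c + 10 * d + 5 * e + f),
      a + 6 * b + 15 * c + 20 * d + 15 * e + 6 * f + g]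
  | _ => []

/-- Integer version of the right half of a subdivision step in degree 6, scaled by `2 ^ 6`. -/
def rightCoeffs (l : List ℤ) : List ℤ := (leftCoeffs l.reverse).reverse

/-- Iterated subdivision of several integer coefficient lists of degree 6, scaled at each step by
`2 ^ 6`. -/
def subCoeffs : ℕ → List (List ℤ) → List (List (List ℤ))
  | 0, d => [d]
  | k + 1, d => subCoeffs k (d.map leftCoeffs) ++ subCoeffs k (d.map rightCoeffs)

/-- Integer vectors defining the directions used to certify embeddedness. -/
def directions : List (ℤ × ℤ) :=
  [(-3, 2), (7, -3), (7, -8), (-9, 11), (-15, 11), (1, -1), (-3, -14)]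

/-- The integer coordinates of the control points of `beta0`. -/
def K0coords : List (ℤ × ℤ × ℤ) :=
  [(0, 9, 20), (-15, -95, -50), (40, 80, -20), (-10, -60, 58), (-60, 30, 20), (40, -60, -60),
    (0, 9, 20)]

/-- The values at the control points of `beta0` of the linear functional given by `c`. -/
def controlCoeffs (c : ℤ × ℤ) : List ℤ :=
  K0coords.map fun v => (3 * c.2 - 10 * c.1) * v.1 + 20 * c.1 * v.2.1 + 20 * c.2 * v.2.2

/-- The `i`-th coefficient of the `u`-th direction in the concatenation of the pieces `T` of
degree 6. -/
def concatCoeff (T : List (List (List ℤ))) (u i : ℕ) : ℤ :=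
  ((T.getD (i % (6 * T.length) / 6) []).getD u []).getD (i % (6 * T.length) % 6) 0

/-- The edges of the concatenation of the pieces `T` of degree 6, given in `m` directions. -/
def edgeCoeffs (m : ℕ) (T : List (List (List ℤ))) : List (List (List ℤ)) :=
  (List.range (6 * T.length)).map fun j =>
    (List.range m).map fun u => [concatCoeff T u j, concatCoeff T u (j + 1)]

theorem certifies_bezier :
    certifies 7 6 (subCoeffs 5 (directions.map controlCoeffs)) = true := by
  decide +kernel

theorem certifies_edges :
    certifies 7 1 (edgeCoeffs 7 (subCoeffs 4 (directions.map controlCoeffs))) = true := by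
  decide +kernel

theorem height_lt : ∀ k, 0 < k → k < 48 →
    concatCoeff (subCoeffs 4 ([(1, 1)].map controlCoeffs)) 0 k <
      concatCoeff (subCoeffs 4 ([(1, 1)].map controlCoeffs)) 0 (96 - k) := by
  have h : ∀ k < 48, 0 < k → concatCoeff (subCoeffs 4 ([(1, 1)].map controlCoeffs)) 0 k <
      concatCoeff (subCoeffs 4 ([(1, 1)].map controlCoeffs)) 0 (96 - k) := by
    decide +kernel
  exact fun k hk hk' => h k hk' hk

theorem length_leftCoeffs {l : List ℤ} (hl : l.length = 7) : (leftCoeffs l).length = 7 := by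
  match l, hl with
  | [_, _, _, _, _, _, _], _ => rfl

theorem length_rightCoeffs {l : List ℤ} (hl : l.length = 7) : (rightCoeffs l).length = 7 := by
  simp [rightCoeffs, length_leftCoeffs, hl]

theorem length_subCoeffs (k : ℕ) (d : List (List ℤ)) : (subCoeffs k d).length = 2 ^ k := by
  induction k generalizing d with
  | zero => rfl
  | succ k ih => simp [subCoeffs, ih]; ring

theorem casteljau_leftCoeffs {l : List ℤ} (hl : l.length = 7) (s : ℝ) :
    casteljau 6 (coeffs (leftCoeffs l)) s = 64 * casteljau 6 (coeffs l) (s / 2) := by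
  match l, hl with
  | [a, b, c, d, e, f, g], _ => simp [leftCoeffs, casteljau, coeffs]; ring

theorem casteljau_rightCoeffs {l : List ℤ} (hl : l.length = 7) (s : ℝ) :
    casteljau 6 (coeffs (rightCoeffs l)) s = 64 * casteljau 6 (coeffs l) ((1 + s) / 2) := by
  match l, hl with
  | [a, b, c, d, e, f, g], _ => simp [rightCoeffs, leftCoeffs, casteljau, coeffs]; ring

theorem getD_map_leftCoeffs (d : List (List ℤ)) (u : ℕ) :
    (d.map leftCoeffs).getD u [] = leftCoeffs (d.getD u []) :=
  List.getD_map (f := leftCoeffs) (d := []) ..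

theorem getD_map_rightCoeffs (d : List (List ℤ)) (u : ℕ) :
    (d.map rightCoeffs).getD u [] = rightCoeffs (d.getD u []) :=
  List.getD_map (f := rightCoeffs) (d := []) ..

theorem casteljau_subCoeffs {k : ℕ} {d : List (List ℤ)} {u j : ℕ}
    (hd : (d.getD u []).length = 7) (hj : j < 2 ^ k) (s : ℝ) :
    casteljau 6 (coeffs (((subCoeffs k d).getD j []).getD u [])) s =
      64 ^ k * casteljau 6 (coeffs (d.getD u [])) ((j + s) / 2 ^ k) := by
  induction k generalizing d j with
  | zero =>
    obtain rfl : j = 0 := by simpa using hj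
    simp [subCoeffs]
  | succ k ih =>
    rcases lt_or_ge j (2 ^ k) with h | h
    · rw [subCoeffs, List.getD_append _ _ _ _ (by rwa [length_subCoeffs]),
        ih (by rw [getD_map_leftCoeffs]; exact length_leftCoeffs hd) h, getD_map_leftCoeffs,
        casteljau_leftCoeffs hd]
      rw [div_div, pow_succ (64 : ℝ), pow_succ (2 : ℝ), mul_assoc]
    · obtain ⟨i, rfl⟩ := Nat.exists_eq_add_of_le h
      rw [subCoeffs, List.getD_append_right _ _ _ _ (by rwa [length_subCoeffs]),
        length_subCoeffs, Nat.add_sub_cancel_left,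
        ih (by rw [getD_map_rightCoeffs]; exact length_rightCoeffs hd) (by omega),
        getD_map_rightCoeffs, casteljau_rightCoeffs hd]
      have : (1 + (i + s) / 2 ^ k) / 2 = (((2 ^ k + i : ℕ) : ℝ) + s) / 2 ^ (k + 1) := by
        push_cast; field_simp; ring
      rw [this, pow_succ (64 : ℝ), mul_assoc]

theorem length_subPolys (n k : ℕ) (P : ℕ → V3) : (subPolys n k P).length = 2 ^ k := by
  induction k generalizing P with
  | zero => rfl
  | succ k ih => simp [subPolys, ih]; ring

theorem coeffs_leftCoeffs {l : List ℤ} (hl : l.length = 7) {P : ℕ → V3} (ℓ : V3 →ₗ[ℝ] ℝ) {c : ℝ}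
    (h : ∀ i ≤ 6, coeffs l i = c * ℓ (P i)) :
    ∀ i ≤ 6, coeffs (leftCoeffs l) i = 64 * c * ℓ (dcLeft P i) := by
  match l, hl with
  | [x₀, x₁, x₂, x₃, x₄, x₅, x₆], _ =>
    have h₀ := h 0 (by decide)
    have h₁ := h 1 (by decide)
    have h₂ := h 2 (by decide)
    have h₃ := h 3 (by decide)
    have h₄ := h 4 (by decide)
    have h₅ := h 5 (by decide)
    have h₆ := h 6 (by decide)
    simp only [coeffs, List.getD_cons_zero, List.getD_cons_succ] at h₀ h₁ h₂ h₃ h₄ h₅ h₆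
    intro i hi
    interval_cases i <;>
      simp [coeffs, leftCoeffs, dcLeft, dcQ, h₀, h₁, h₂, h₃, h₄, h₅, h₆] <;> ring

theorem coeffs_rightCoeffs {l : List ℤ} (hl : l.length = 7) {P : ℕ → V3} (ℓ : V3 →ₗ[ℝ] ℝ) {c : ℝ}
    (h : ∀ i ≤ 6, coeffs l i = c * ℓ (P i)) :
    ∀ i ≤ 6, coeffs (rightCoeffs l) i = 64 * c * ℓ (dcRight 6 P i) := by
  match l, hl with
  | [x₀, x₁, x₂, x₃, x₄, x₅, x₆], _ =>
    have h₀ := h 0 (by decide)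
    have h₁ := h 1 (by decide)
    have h₂ := h 2 (by decide)
    have h₃ := h 3 (by decide)
    have h₄ := h 4 (by decide)
    have h₅ := h 5 (by decide)
    have h₆ := h 6 (by decide)
    simp only [coeffs, List.getD_cons_zero, List.getD_cons_succ] at h₀ h₁ h₂ h₃ h₄ h₅ h₆
    intro i hi
    interval_cases i <;>
      simp [coeffs, rightCoeffs, leftCoeffs, dcRight, dcQ, h₀, h₁, h₂, h₃, h₄, h₅, h₆] <;> ring

theorem coeffs_subCoeffs {k : ℕ} {d : List (List ℤ)} {u j : ℕ} {P : ℕ → V3} (ℓ : V3 →ₗ[ℝ] ℝ)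
    {c : ℝ} (hd : (d.getD u []).length = 7) (h : ∀ i ≤ 6, coeffs (d.getD u []) i = c * ℓ (P i))
    (hj : j < 2 ^ k) :
    ∀ i ≤ 6, coeffs (((subCoeffs k d).getD j []).getD u []) i =
      64 ^ k * c * ℓ ((subPolys 6 k P).getD j (fun _ => 0) i) := by
  induction k generalizing d j P c with
  | zero =>
    obtain rfl : j = 0 := by simpa using hj
    simpa [subCoeffs, subPolys] using h
  | succ k ih =>
    rw [pow_succ, mul_assoc]
    rcases lt_or_ge j (2 ^ k) with h' | h'
    · rw [subCoeffs, List.getD_append _ _ _ _ (by rwa [length_subCoeffs]), subPolys,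
        List.getD_append _ _ _ _ (by rwa [length_subPolys])]
      refine ih ?_ ?_ h' <;> rw [getD_map_leftCoeffs]
      exacts [length_leftCoeffs hd, coeffs_leftCoeffs hd ℓ h]
    · rw [subCoeffs, List.getD_append_right _ _ _ _ (by rwa [length_subCoeffs]), subPolys,
        List.getD_append_right _ _ _ _ (by rwa [length_subPolys]), length_subCoeffs,
        length_subPolys]
      refine ih ?_ ?_ (by omega) <;> rw [getD_map_rightCoeffs]
      exacts [length_rightCoeffs hd, coeffs_rightCoeffs hd ℓ h]

theorem concatCoeff_eq {k : ℕ} {d : List (List ℤ)} {u : ℕ} {P : ℕ → V3} (ℓ : V3 →ₗ[ℝ] ℝ)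
    (hd : (d.getD u []).length = 7) (h : ∀ i ≤ 6, coeffs (d.getD u []) i = ℓ (P i)) (i : ℕ) :
    (concatCoeff (subCoeffs k d) u i : ℝ) = 64 ^ k * ℓ (concatVerts 6 (subPolys 6 k P) i) := by
  have hlt : i % (6 * 2 ^ k) / 6 < 2 ^ k :=
    Nat.div_lt_of_lt_mul (Nat.mod_lt _ (by positivity))
  have := coeffs_subCoeffs (k := k) (c := 1) (P := P) ℓ hd (by simpa using h) hlt
    (i % (6 * 2 ^ k) % 6) (by omega)
  simpa [concatCoeff, concatVerts, length_subCoeffs, length_subPolys, coeffs] using this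

/-! ### Piecewise linear paths -/

theorem plPath_apply (P : ℕ → V3) {m k : ℕ} (hm : 0 < m) {s : ℝ} (hs : s ∈ Icc (0 : ℝ) 1) :
    plPath P m ((k + s) / m) = (1 - s) • P k + s • P (k + 1) := by
  have hm' : (m : ℝ) ≠ 0 := by positivity
  rcases eq_or_lt_of_le hs.2 with rfl | h
  · have : ((k : ℝ) + 1) = ((k + 1 : ℕ) : ℤ) := by push_cast; rfl
    simp only [plPath, div_mul_cancel₀ _ hm', this, Int.floor_intCast]
    simp
  · have : ⌊(k : ℝ) + s⌋ = k := by
      rw [Int.floor_eq_iff]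
      constructor <;> push_cast <;> linarith [hs.1]
    simp [plPath, div_mul_cancel₀ _ hm', this]

theorem continuousOn_plPath (P : ℕ → V3) {m : ℕ} (hm : 0 < m) :
    ContinuousOn (plPath P m) (Icc 0 1) := by
  have hm' : (0 : ℝ) < m := Nat.cast_pos.2 hm
  have key : ∀ n : ℕ, ContinuousOn (plPath P m) (Icc 0 (n / m)) := by
    intro n
    induction n with
    | zero => simp
    | succ n ih =>
      have h1 : (n : ℝ) / m ≤ (n + 1 : ℕ) / m := by gcongr; simp
      rw [← Icc_union_Icc_eq_Icc (by positivity : (0 : ℝ) ≤ n / m) h1]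
      refine ih.union_of_isClosed ?_ isClosed_Icc isClosed_Icc
      have h2 : Continuous fun t : ℝ => (1 - (t * m - n)) • P n + (t * m - n) • P (n + 1) := by
        fun_prop
      refine h2.continuousOn.congr fun t ht => ?_
      rw [mem_Icc, div_le_iff₀ hm', le_div_iff₀ hm'] at ht
      push_cast at ht
      have h3 : t * m - n ∈ Icc (0 : ℝ) 1 := ⟨by linarith [ht.1], by linarith [ht.2]⟩
      refine (congrArg (plPath P m) ?_).trans (plPath_apply P hm h3)
      field_simp
      ring
  simpa [hm'.ne'] using key m

/-! ### The two curves -/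

/-- The linear functional on `V3` factoring through the projection in the direction
`(20, 10, -3)` that corresponds to the integer vector `c`. -/
def functional (c : ℤ × ℤ) : V3 →ₗ[ℝ] ℝ where
  toFun v := 20 * (c.1 * (v 1 - v 0 / 2) + c.2 * (v 2 + v 0 * (3 / 20)))
  map_add' v w := by simp only [Pi.add_apply]; ring
  map_smul' r v := by simp only [Pi.smul_apply, smul_eq_mul, RingHom.id_apply]; ring

theorem functional_apply (c : ℤ × ℤ) (v : V3) :
    functional c v = 20 * (c.1 * (v 1 - v 0 / 2) + c.2 * (v 2 + v 0 * (3 / 20))) := rfl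

theorem coeffs_controlCoeffs (c : ℤ × ℤ) :
    ∀ i ≤ 6, coeffs (controlCoeffs c) i = functional c (vertsOf K0verts i) := by
  intro i hi
  interval_cases i <;>
    simp [coeffs, controlCoeffs, K0coords, functional_apply, vertsOf, K0verts] <;> ring

theorem casteljau_congr {n : ℕ} {p q : ℕ → ℝ} (h : ∀ i ≤ n, p i = q i) (s : ℝ) :
    casteljau n p s = casteljau n q s := by
  induction n generalizing p q with
  | zero => exact h 0 le_rfl
  | succ n ih =>
    rw [casteljau, casteljau, ih fun i hi => h i (by omega),
      ih (p := fun i => p (i + 1)) fun i hi => h (i + 1) (by omega)]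

theorem functional_beta0 (c : ℤ × ℤ) (t : ℝ) :
    functional c (beta0 t) = casteljau 6 (coeffs (controlCoeffs c)) t := by
  rw [casteljau_congr (coeffs_controlCoeffs c), beta0, bezier]
  simp [Finset.sum_range_succ, casteljau, Nat.choose]
  ring

theorem getD_controlCoeffs {u : ℕ} (hu : u < 7) :
    (directions.map controlCoeffs).getD u [] = controlCoeffs (directions.getD u 0) := by
  interval_cases u <;> rfl

theorem functional_congr {v w : V3} (h₁ : v 1 - v 0 / 2 = w 1 - w 0 / 2)
    (h₂ : v 2 + v 0 * (3 / 20) = w 2 + w 0 * (3 / 20)) (c : ℤ × ℤ) :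
    functional c v = functional c w := by
  rw [functional_apply, functional_apply, h₁, h₂]

theorem ambientIsotopic_beta0_unitCircle : AmbientIsotopic (beta0 '' Icc 0 1) unitCircle := by
  have hcont : Continuous beta0 := by unfold beta0 bezier; fun_prop
  have h01 : beta0 0 = beta0 1 := by
    simp [beta0, bezier, Finset.sum_range_succ, vertsOf, K0verts]
  refine ambientIsotopic_unitCircle_of_projection hcont.continuousOn h01 ?_ ?_
  · intro s hs t ht h₁ h₂
    refine injective_of_certifies (N := 2 ^ 5) (by decide) (by decide) (length_subCoeffs 5 _)
      certifies_bezier (h := fun u t => 64 ^ 5 * functional (directions.getD u 0) (beta0 t))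
      ?_ hs ht fun u _ => congrArg _ (functional_congr h₁ h₂ _)
    intro j hj u hu s _
    rw [casteljau_subCoeffs (by rw [getD_controlCoeffs hu]; rfl) hj, getD_controlCoeffs hu,
      functional_beta0, Nat.cast_pow, Nat.cast_ofNat]
  · rintro t ⟨h0, h1⟩ h
    have e : functional (1, 1) (beta0 t) = functional (1, 1) (beta0 (1 - t)) := by
      simp only [functional_apply]; push_cast; linarith
    rw [functional_beta0, functional_beta0] at e
    simp [casteljau, coeffs, controlCoeffs, K0coords] at e
    have p1 : 0 < t * (1 - t) := mul_pos h0 (by linarith)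
    have p2 : 0 < t * (1 - t) * (1 - 2 * t) := mul_pos p1 (by linarith)
    have p3 := mul_pos p2 p1
    have p4 := mul_pos p2 (pow_pos h0 2)
    have p5 := mul_pos p2 (pow_pos (by linarith : 0 < 1 - t) 2)
    nlinarith [mul_pos p3 p1]

theorem ambientIsotopic_Ksub_unitCircle :
    AmbientIsotopic (Ksub 4 (vertsOf K0verts) '' Icc 0 1) unitCircle := by
  set P := concatVerts 6 (subPolys 6 4 (vertsOf K0verts)) with hP
  have happ : ∀ (k : ℕ) (s : ℝ), s ∈ Icc (0 : ℝ) 1 →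
      Ksub 4 (vertsOf K0verts) ((k + s) / 96) = (1 - s) • P k + s • P (k + 1) := by
    intro k s hs
    have := plPath_apply P (m := 6 * 2 ^ 4) (k := k) (by decide) hs
    rw [← this, Ksub, ← hP]
    norm_num
  have h01 : Ksub 4 (vertsOf K0verts) 0 = Ksub 4 (vertsOf K0verts) 1 := by
    have e0 := happ 0 0 (by simp)
    have e1 := happ 95 1 (by simp)
    have e : P 96 = P 0 := by simp [hP, concatVerts, length_subPolys]
    norm_num [e] at e0 e1
    rw [e0, e1]
  refine ambientIsotopic_unitCircle_of_projection (continuousOn_plPath _ (by decide)) h01 ?_ ?_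
  · intro s hs t ht h₁ h₂
    refine injective_of_certifies (N := 96) (by decide) (by decide)
      (by simp [edgeCoeffs, length_subCoeffs])
      certifies_edges (h := fun u t => 64 ^ 4 * functional (directions.getD u 0)
        (Ksub 4 (vertsOf K0verts) t)) ?_ hs ht fun u _ => congrArg _ (functional_congr h₁ h₂ _)
    intro j hj u hu s hs
    have hc := concatCoeff_eq (k := 4) (d := directions.map controlCoeffs) (u := u)
      (P := vertsOf K0verts) (functional (directions.getD u 0))
      (by rw [getD_controlCoeffs hu]; rfl)
      (by rw [getD_controlCoeffs hu]; exact coeffs_controlCoeffs _)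
    have hE : ((edgeCoeffs 7 (subCoeffs 4 (directions.map controlCoeffs))).getD j []).getD u [] =
        [concatCoeff (subCoeffs 4 (directions.map controlCoeffs)) u j,
          concatCoeff (subCoeffs 4 (directions.map controlCoeffs)) u (j + 1)] := by
      have hj' : j < 6 * (subCoeffs 4 (directions.map controlCoeffs)).length := by
        rw [length_subCoeffs]; exact hj
      simp [edgeCoeffs, hj', hu]
    rw [hE]
    simp only [casteljau, coeffs, List.getD_cons_zero, List.getD_cons_succ, hc, zero_add]
    push_cast
    rw [happ j s ⟨hs.1, hs.2.le⟩, map_add, map_smul, map_smul, smul_eq_mul, smul_eq_mul]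
    ring
  · rintro t ⟨h0, h1⟩ h
    have hc := concatCoeff_eq (k := 4) (d := [(1, 1)].map controlCoeffs) (u := 0)
      (P := vertsOf K0verts) (functional (1, 1)) rfl (coeffs_controlCoeffs _)
    have hlt : ∀ k, 0 < k → k < 48 → functional (1, 1) (P k) < functional (1, 1) (P (96 - k)) := by
      intro k hk hk'
      have := Int.cast_lt (R := ℝ).2 (height_lt k hk hk')
      rw [hc, hc] at this
      linarith
    have hle : ∀ k < 49, functional (1, 1) (P k) ≤ functional (1, 1) (P (96 - k)) := by
      intro k hk
      rcases Nat.eq_zero_or_pos k with rfl | hk0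
      · simp [hP, concatVerts, length_subPolys]
      · rcases Nat.lt_or_ge k 48 with hk' | hk'
        · exact (hlt k hk0 hk').le
        · obtain rfl : k = 48 := by omega
          rfl
    have e : functional (1, 1) (Ksub 4 (vertsOf K0verts) t) =
        functional (1, 1) (Ksub 4 (vertsOf K0verts) (1 - t)) := by
      simp only [functional_apply]; push_cast; linarith
    obtain ⟨k, s, hk, hs, rfl⟩ : ∃ k : ℕ, ∃ s : ℝ, k < 48 ∧ s ∈ Ico (0 : ℝ) 1 ∧
        t = (k + s) / 96 := by
      refine ⟨⌊t * 96⌋₊, t * 96 - ⌊t * 96⌋₊, ?_, ⟨?_, ?_⟩, by ring⟩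
      · rw [Nat.floor_lt (by positivity)]; push_cast; linarith
      · exact sub_nonneg.2 (Nat.floor_le (by positivity))
      · linarith [Nat.lt_floor_add_one (t * 96)]
    have e' : (1 : ℝ) - (k + s) / 96 = ((95 - k : ℕ) + (1 - s)) / 96 := by
      rw [Nat.cast_sub (by omega)]; push_cast; ring
    rw [e', happ k s ⟨hs.1, hs.2.le⟩, happ _ (1 - s) ⟨by linarith [hs.2], by linarith [hs.1]⟩,
      show 95 - k + 1 = 96 - k by omega] at e
    simp only [map_add, map_smul, smul_eq_mul] at e
    have hk1 := hle (k + 1) (by omega)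
    rw [show 96 - (k + 1) = 95 - k by omega] at hk1
    have hk2 := hle k (by omega)
    rcases Nat.eq_zero_or_pos k with rfl | hk0
    · have hs0 : 0 < s := by simpa using h0
      have h3 := mul_lt_mul_of_pos_left (hlt 1 (by decide) (by decide)) hs0
      have h4 := mul_le_mul_of_nonneg_left hk2 (sub_nonneg.2 hs.2.le)
      simp only [zero_add, Nat.sub_zero, Nat.reduceSub] at e h3 h4
      linarith
    · have h3 := mul_le_mul_of_nonneg_left hk1 hs.1
      have h4 := mul_lt_mul_of_pos_left (hlt k hk0 hk) (sub_pos.2 hs.2)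
      linarith

/-- There is an ambient isotopy between the image of β₀ and the
closed PL curve K₀,₄; consequently the image of β₀ is the unknot, i.e. it is
ambient isotopic to the round circle {(x,y,0) : x² + y² = 1}. -/
theorem beta0_isotopic_K04_and_unknot :
    AmbientIsotopic (beta0 '' Icc 0 1) (Ksub 4 (vertsOf K0verts) '' Icc 0 1) ∧
      AmbientIsotopic (beta0 '' Icc 0 1) unitCircle := by
  exact ⟨ambientIsotopic_beta0_unitCircle.trans ambientIsotopic_Ksub_unitCircle.symm,
    ambientIsotopic_beta0_unitCircle⟩
end
end

section
/- For s ∈ [0,1], let C_s be the degree-6 Bézier curve with control points (0,9,20), (−15,−95,−50), (40,80,−20), (−10+20s,−60,58), (−60,30,20), (40,−60,−60), (0,9,20) (so C_0 = β_0 and C_1 = β_1). Then there exists s̃ ∈ [0,1] such that C_{s̃} has a self-intersection: there are t, u ∈ [0,1) with t ≠ u and C_{s̃}(t) = C_{s̃}(u). -/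
open Set Real

noncomputable section

/-- The family of degree-6 Bézier curves `C_s`, `s ∈ [0,1]`, with control
points (0,9,20), (−15,−95,−50), (40,80,−20), (−10+20s,−60,58), (−60,30,20),
(40,−60,−60), (0,9,20); so `C 0 = β₀` and `C 1 = β₁`. -/
def Cfam (s : ℝ) : ℝ → V3 :=
  bezier 6 (vertsOf
    [pt 0 9 20, pt (-15) (-95) (-50), pt 40 80 (-20), pt (-10 + 20 * s) (-60) 58,
     pt (-60) 30 20, pt 40 (-60) (-60)])

/-- Two quadratics with vanishing resultant share the root given by eliminating the
leading terms. -/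
theorem quadratics_common_root {a₁ b₁ c₁ a₂ b₂ c₂ : ℝ} (hD : a₁ * b₂ - a₂ * b₁ ≠ 0)
    (hR : (a₁ * c₂ - a₂ * c₁) ^ 2 = (a₁ * b₂ - a₂ * b₁) * (b₁ * c₂ - b₂ * c₁)) :
    ∃ q : ℝ, q * (a₁ * b₂ - a₂ * b₁) = -(a₁ * c₂ - a₂ * c₁) ∧
      a₁ * q ^ 2 + b₁ * q + c₁ = 0 ∧ a₂ * q ^ 2 + b₂ * q + c₂ = 0 := by
  obtain ⟨q, hq⟩ : ∃ q : ℝ, q * (a₁ * b₂ - a₂ * b₁) = -(a₁ * c₂ - a₂ * c₁) :=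
    ⟨_, div_mul_cancel₀ _ hD⟩
  refine ⟨q, hq, ?_, ?_⟩
  · refine (mul_eq_zero.mp ?_).resolve_left (pow_ne_zero 2 hD)
    linear_combination a₁ * hR + (a₁ * (q * (a₁ * b₂ - a₂ * b₁) - (a₁ * c₂ - a₂ * c₁)) +
      b₁ * (a₁ * b₂ - a₂ * b₁)) * hq
  · refine (mul_eq_zero.mp ?_).resolve_left (pow_ne_zero 2 hD)
    linear_combination a₂ * hR + (a₂ * (q * (a₁ * b₂ - a₂ * b₁) - (a₁ * c₂ - a₂ * c₁)) +
      b₂ * (a₁ * b₂ - a₂ * b₁)) * hq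

/-- The divided differences of the second and third coordinates of `Cfam s`, written in terms of
the sum `p` and the product `q` of the two parameters, have a common zero. -/
theorem exists_dividedDifferences_eq_zero :
    ∃ p ∈ Icc (0.5215 : ℝ) 0.5217, ∃ q ∈ Icc (0.0144 : ℝ) 0.0168,
      (-12564 + 11394 * p) * q ^ 2 + (11880 - 34170 * p + 37692 * p ^ 2 - 15192 * p ^ 3) * q +
        (-624 + 4185 * p - 11880 * p ^ 2 + 17085 * p ^ 3 - 12564 * p ^ 4 + 3798 * p ^ 5) = 0 ∧
      (2100 - 1380 * p) * q ^ 2 + (1040 + 3360 * p - 6300 * p ^ 2 + 1840 * p ^ 3) * q +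
        (-420 + 1500 * p - 1040 * p ^ 2 - 1680 * p ^ 3 + 2100 * p ^ 4 - 460 * p ^ 5) = 0 := by
  set D : ℝ → ℝ := fun p => -211192 + 321034 * p - 49282 * p ^ 2 - 61010 * p ^ 3 with hD
  set E : ℝ → ℝ := fun p => 36596 - 184895 * p + 338227 * p ^ 2 - 238973 * p ^ 3 +
    24641 * p ^ 4 + 24404 * p ^ 5 with hE
  set G : ℝ → ℝ := fun p => (-72344 + 498594 * p - 1417974 * p ^ 2 + 2135985 * p ^ 3 -
    1775292 * p ^ 4 + 716919 * p ^ 5 - 49282 * p ^ 6 - 36606 * p ^ 7) / 3 with hG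
  obtain ⟨p, hp, hR⟩ : ∃ p ∈ Icc (0.5215 : ℝ) 0.5217, E p ^ 2 - D p * G p = 0 := by
    apply intermediate_value_Icc (by norm_num)
    · fun_prop
    · simp only [hD, hE, hG]
      constructor <;> norm_num
  have bounds (n : ℕ) : (0.5215 : ℝ) ^ n ≤ p ^ n ∧ p ^ n ≤ 0.5217 ^ n :=
    ⟨pow_le_pow_left₀ (by norm_num) hp.1 n, pow_le_pow_left₀ (by linarith [hp.1]) hp.2 n⟩
  obtain ⟨h1, h1'⟩ := hp
  obtain ⟨h2, h2'⟩ := bounds 2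
  obtain ⟨h3, h3'⟩ := bounds 3
  obtain ⟨h4, h4'⟩ := bounds 4
  obtain ⟨h5, h5'⟩ := bounds 5
  norm_num at h1 h1' h2 h2' h3 h3' h4 h4' h5 h5'
  have hDneg : D p < 0 := by simp only [hD]; linarith
  obtain ⟨q, hq, hy, hz⟩ := quadratics_common_root
    (a₁ := -12564 + 11394 * p) (b₁ := 11880 - 34170 * p + 37692 * p ^ 2 - 15192 * p ^ 3)
    (c₁ := -624 + 4185 * p - 11880 * p ^ 2 + 17085 * p ^ 3 - 12564 * p ^ 4 + 3798 * p ^ 5)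
    (a₂ := 2100 - 1380 * p) (b₂ := 1040 + 3360 * p - 6300 * p ^ 2 + 1840 * p ^ 3)
    (c₂ := -420 + 1500 * p - 1040 * p ^ 2 - 1680 * p ^ 3 + 2100 * p ^ 4 - 460 * p ^ 5)
    (by
      have : 180 * D p ≠ 0 := mul_ne_zero (by norm_num) hDneg.ne
      convert this using 1
      simp only [hD]; ring)
    (by simp only [hD, hE, hG] at hR; linear_combination 32400 * hR)
  have hqD : q * D p = -E p := by
    simp only [hD, hE]; linear_combination hq / 180
  refine ⟨p, ⟨by norm_num; exact h1, by norm_num; exact h1'⟩, q, ⟨?_, ?_⟩, hy, hz⟩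
  · refine le_of_mul_le_mul_right (a := -D p) ?_ (neg_pos.mpr hDneg)
    rw [mul_neg, mul_neg, hqD]; simp only [hD, hE]; linarith
  · refine le_of_mul_le_mul_right (a := -D p) ?_ (neg_pos.mpr hDneg)
    rw [mul_neg, mul_neg, hqD]; simp only [hD, hE]; linarith

/-- The coordinates of `Cfam s t` in the monomial basis. -/
theorem Cfam_eq (s t : ℝ) : Cfam s t = pt
    (-90 * t + 1050 * t ^ 2 - 3500 * t ^ 3 + 4200 * t ^ 4 - 1410 * t ^ 5 - 250 * t ^ 6 +
      s * (400 * t ^ 3 - 1200 * t ^ 4 + 1200 * t ^ 5 - 400 * t ^ 6))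
    (9 - 624 * t + 4185 * t ^ 2 - 11880 * t ^ 3 + 17085 * t ^ 4 - 12564 * t ^ 5 + 3798 * t ^ 6)
    (20 - 420 * t + 1500 * t ^ 2 - 1040 * t ^ 3 - 1680 * t ^ 4 + 2100 * t ^ 5 - 460 * t ^ 6) := by
  have h62 : Nat.choose 6 2 = 15 := rfl
  have h63 : Nat.choose 6 3 = 20 := rfl
  have h64 : Nat.choose 6 4 = 15 := rfl
  ext i
  fin_cases i <;>
    simp [Cfam, bezier, vertsOf, pt, Finset.sum_range_succ, h62, h63, h64] <;> ring

/-- some curve `C s` with `s ∈ [0,1]` has a self-intersection: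
there are `t ≠ u` in `[0,1)` with `C s t = C s u`. -/
theorem exists_selfIntersecting_bezier :
    ∃ s ∈ Icc (0 : ℝ) 1, ∃ t ∈ Ico (0 : ℝ) 1, ∃ u ∈ Ico (0 : ℝ) 1,
      t ≠ u ∧ Cfam s t = Cfam s u := by
  obtain ⟨p, ⟨hp, hp'⟩, q, ⟨hq, hq'⟩, hy, hz⟩ := exists_dividedDifferences_eq_zero
  obtain ⟨t, u, rfl, rfl, htu, ht, hu⟩ : ∃ t u : ℝ, t + u = p ∧ t * u = q ∧ t < u ∧
      0 ≤ t ∧ u < 1 := by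
    have hpos : 0 < p ^ 2 - 4 * q := by nlinarith
    have hsq := Real.sq_sqrt hpos.le
    have hd := Real.sqrt_pos.mpr hpos
    have hdp : √(p ^ 2 - 4 * q) ≤ p := by
      apply Real.sqrt_le_iff.mpr
      constructor <;> linarith
    exact ⟨(p - √(p ^ 2 - 4 * q)) / 2, (p + √(p ^ 2 - 4 * q)) / 2, by ring,
      by linear_combination -hsq / 4, by linarith, by linarith, by linarith⟩
  set p := t + u with hpdef
  set q := t * u with hqdef
  have bounds (n : ℕ) : (0.5215 : ℝ) ^ n ≤ p ^ n ∧ p ^ n ≤ 0.5217 ^ n :=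
    ⟨pow_le_pow_left₀ (by norm_num) hp n, pow_le_pow_left₀ (by linarith) hp' n⟩
  obtain ⟨h2, h2'⟩ := bounds 2
  obtain ⟨h3, h3'⟩ := bounds 3
  obtain ⟨h4, h4'⟩ := bounds 4
  obtain ⟨h5, h5'⟩ := bounds 5
  norm_num at hp hp' hq hq' h2 h2' h3 h3' h4 h4' h5 h5'
  set X : ℝ := (-1410 - 750 * p) * q ^ 2 + (3500 - 8400 * p + 4230 * p ^ 2 + 1000 * p ^ 3) * q +
    (-90 + 1050 * p - 3500 * p ^ 2 + 4200 * p ^ 3 - 1410 * p ^ 4 - 250 * p ^ 5) with hX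
  set S : ℝ := (1200 - 1200 * p) * q ^ 2 + (-400 + 2400 * p - 3600 * p ^ 2 + 1600 * p ^ 3) * q +
    (400 * p ^ 2 - 1200 * p ^ 3 + 1200 * p ^ 4 - 400 * p ^ 5) with hS
  have hXneg : X ≤ 0 := by
    have : (3500 - 8400 * p + 4230 * p ^ 2 + 1000 * p ^ 3) * q ≤ 413 * 0.0168 :=
      mul_le_mul (by linarith) (by linarith) (by linarith) (by norm_num)
    have : (-1410 - 750 * p) * q ^ 2 ≤ 0 :=
      mul_nonpos_of_nonpos_of_nonneg (by linarith) (sq_nonneg q)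
    linarith
  have hSX : 11 ≤ S ∧ -X ≤ 11 := by
    have hqq : q ^ 2 ≤ 0.0168 ^ 2 := pow_le_pow_left₀ (by linarith) (by linarith) 2
    have : (0 : ℝ) ≤ (-400 + 2400 * p - 3600 * p ^ 2 + 1600 * p ^ 3) * q :=
      mul_nonneg (by linarith) (by linarith)
    have : 0 ≤ (1200 - 1200 * p) * q ^ 2 := mul_nonneg (by linarith) (sq_nonneg q)
    have : 409 * 0.0144 ≤ (3500 - 8400 * p + 4230 * p ^ 2 + 1000 * p ^ 3) * q :=
      mul_le_mul (by linarith) (by linarith) (by norm_num) (by linarith)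
    have : (1410 + 750 * p) * q ^ 2 ≤ 1802 * 0.0168 ^ 2 :=
      mul_le_mul (by linarith) hqq (sq_nonneg q) (by norm_num)
    constructor <;> linarith
  obtain ⟨hS11, hX11⟩ := hSX
  have hS0 : S ≠ 0 := by linarith
  have hs : X + -X / S * S = 0 := by rw [div_mul_cancel₀ _ hS0]; ring
  refine ⟨-X / S, ⟨div_nonneg (by linarith) (by linarith),
    (div_le_one (by linarith)).mpr (by linarith)⟩, t, ⟨ht, by linarith⟩, u, ⟨by linarith, hu⟩,
    htu.ne, ?_⟩
  generalize -X / S = s at hs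
  rw [Cfam_eq, Cfam_eq]
  rw [hX, hS] at hs
  rw [hpdef, hqdef] at hs hy hz
  congr 1
  · linear_combination (t - u) * hs
  · linear_combination (t - u) * hy
  · linear_combination (t - u) * hz
end
end

section
/- Variation diminishing property: let P_0,…,P_n ∈ ℝ³ be control points, C the associated Bézier curve, and L : [0,1] → ℝ³ the standard parameterization of the control polygon (the piecewise linear curve interpolating P_0,…,P_n in order). For every affine plane Π ⊆ ℝ³, if the set {t ∈ [0,1] : L(t) ∈ Π} is finite, then the set {t ∈ [0,1] : C(t) ∈ Π} is finite and its cardinality is at most that of {t ∈ [0,1] : L(t) ∈ Π}. -/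
open Set Real

noncomputable section

/-- The piecewise linear function on `[0,1]` with value `a i` at `i / n`. -/
def plInterp (a : ℕ → ℝ) (n : ℕ) (t : ℝ) : ℝ :=
  (1 - (t * n - ⌊t * n⌋₊)) * a ⌊t * n⌋₊ + (t * n - ⌊t * n⌋₊) * a (⌊t * n⌋₊ + 1)

/-- The polynomial function with Bernstein coefficients `a 0, …, a n`. -/
def bernsteinSum (a : ℕ → ℝ) (n : ℕ) (t : ℝ) : ℝ :=
  ∑ i ∈ Finset.range (n + 1), ((n.choose i : ℝ) * t ^ i * (1 - t) ^ (n - i)) * a i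

theorem sum_mul_plPath (n : ℕ) (P : ℕ → V3) (ν : V3) (c t : ℝ) :
    ∑ j, ν j * plPath P n t j = plInterp (fun i => ∑ j, ν j * P i j - c) n t + c := by
  simp only [plPath, plInterp, Fin.sum_univ_three, Pi.add_apply, Pi.smul_apply, smul_eq_mul,
    Int.floor_toNat]
  ring

theorem sum_mul_bezier (n : ℕ) (P : ℕ → V3) (ν : V3) (c t : ℝ) :
    ∑ j, ν j * bezier n P t j = bernsteinSum (fun i => ∑ j, ν j * P i j - c) n t + c := by
  have hone : ∑ i ∈ Finset.range (n + 1), (n.choose i : ℝ) * t ^ i * (1 - t) ^ (n - i) = 1 := by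
    have h := add_pow t (1 - t) n
    rw [add_sub_cancel, one_pow] at h
    refine Eq.trans ?_ h.symm
    exact Finset.sum_congr rfl fun i _ => by ring
  simp only [bezier, bernsteinSum, mul_sub, Finset.sum_sub_distrib, ← Finset.sum_mul, hone,
    Finset.sum_apply, Pi.smul_apply, smul_eq_mul, one_mul, sub_add_cancel, Finset.mul_sum]
  rw [Finset.sum_comm]
  exact Finset.sum_congr rfl fun i _ => Finset.sum_congr rfl fun j _ => by ring

theorem plInterp_div {n : ℕ} (hn : n ≠ 0) (a : ℕ → ℝ) (i : ℕ) : plInterp a n (i / n) = a i := by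
  have hn' : (n : ℝ) ≠ 0 := Nat.cast_ne_zero.mpr hn
  simp [plInterp, div_mul_cancel₀ _ hn']

theorem plInterp_zero (a : ℕ → ℝ) (n : ℕ) : plInterp a n 0 = a 0 := by simp [plInterp]

theorem plInterp_one (a : ℕ → ℝ) (n : ℕ) : plInterp a n 1 = a n := by simp [plInterp]

theorem bernsteinSum_zero (a : ℕ → ℝ) (n : ℕ) : bernsteinSum a n 0 = a 0 := by
  simp [bernsteinSum, Finset.sum_range_succ']

theorem bernsteinSum_one (a : ℕ → ℝ) (n : ℕ) : bernsteinSum a n 1 = a n := by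
  rw [bernsteinSum, Finset.sum_range_succ, Finset.sum_eq_zero]
  · simp
  · intro i hi
    have : n - i ≠ 0 := by have := Finset.mem_range.mp hi; omega
    simp [this]

theorem plInterp_neg (a : ℕ → ℝ) (n : ℕ) (t : ℝ) :
    plInterp (fun i => -a i) n t = -plInterp a n t := by
  simp only [plInterp]; ring

/-- On the edge from `a i` to `a (i + 1)`, the interpolant vanishes where the line does. -/
theorem exists_plInterp_eq_zero_of_edge {n : ℕ} (hn : n ≠ 0) {a : ℕ → ℝ} {i : ℕ}
    (h₀ : 0 < a i) (h₁ : a (i + 1) < 0) :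
    ∃ z ∈ Ioo ((i : ℝ) / n) ((i + 1 : ℕ) / n), plInterp a n z = 0 := by
  have hn' : (0 : ℝ) < n := by positivity
  have hd : 0 < a i - a (i + 1) := by linarith
  set r := a i / (a i - a (i + 1)) with hr
  have hr0 : 0 < r := div_pos h₀ hd
  have hr1 : r < 1 := (div_lt_one hd).mpr (by linarith)
  have hs : (i + r) / n * n = i + r := div_mul_cancel₀ _ hn'.ne'
  have hfl : ⌊(i : ℝ) + r⌋₊ = i :=
    (Nat.floor_eq_iff (by positivity)).mpr ⟨by linarith, by linarith⟩
  refine ⟨(i + r) / n, ⟨by gcongr; linarith, by push_cast; gcongr⟩, ?_⟩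
  rw [plInterp, hs, hfl, add_sub_cancel_left, hr]
  field_simp
  ring

theorem exists_plInterp_eq_zero_of_pos_of_neg {n : ℕ} (hn : n ≠ 0) {a : ℕ → ℝ} {i k : ℕ}
    (hik : i < k) (h₀ : 0 < a i) (h₁ : a k < 0) :
    ∃ z ∈ Ioo ((i : ℝ) / n) (k / n), plInterp a n z = 0 := by
  have hn' : (0 : ℝ) < n := by positivity
  induction k, hik using Nat.le_induction with
  | base => exact exists_plInterp_eq_zero_of_edge hn h₀ h₁
  | succ k hk ih =>
    have hlt : (k : ℝ) / n < (k + 1 : ℕ) / n := by gcongr; simp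
    have hik : (i : ℝ) / n < k / n := by gcongr; exact hk
    rcases lt_trichotomy (a k) 0 with h | h | h
    · obtain ⟨z, hz, hz0⟩ := ih h
      exact ⟨z, ⟨hz.1, hz.2.trans hlt⟩, hz0⟩
    · exact ⟨k / n, ⟨hik, hlt⟩, by rw [plInterp_div hn, h]⟩
    · obtain ⟨z, hz, hz0⟩ := exists_plInterp_eq_zero_of_edge hn h h₁
      exact ⟨z, ⟨hik.trans hz.1, hz.2⟩, hz0⟩

theorem exists_plInterp_eq_zero_of_mul_neg {n : ℕ} (hn : n ≠ 0) {a : ℕ → ℝ} {i k : ℕ}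
    (hik : i < k) (h : a k * a i < 0) :
    ∃ z ∈ Ioo ((i : ℝ) / n) (k / n), plInterp a n z = 0 := by
  rcases mul_neg_iff.mp h with ⟨hk, hi⟩ | ⟨hk, hi⟩
  · obtain ⟨z, hz, hz0⟩ := exists_plInterp_eq_zero_of_pos_of_neg hn (a := fun i => -a i) hik
      (neg_pos.mpr hi) (neg_neg_of_pos hk)
    exact ⟨z, hz, by rwa [plInterp_neg, neg_eq_zero] at hz0⟩
  · exact exists_plInterp_eq_zero_of_pos_of_neg hn hik hi hk

/-- The sign variations of a polynomial are witnessed by a decreasing list of exponents along which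
the coefficients alternate in sign. -/
theorem exists_list_coeff_alternating (p : Polynomial ℝ) :
    ∃ l : List ℕ, p.signVariations = l.length - 1 ∧ l.Pairwise (· > ·) ∧
      (∀ i ∈ l, i ≤ p.natDegree) ∧ l.IsChain fun i k => p.coeff i * p.coeff k < 0 := by
  set s := (p.coeffList.map SignType.sign).filter (· ≠ 0)
  have hsub : (s.destutter (· ≠ ·)).Sublist (p.coeffList.map SignType.sign) :=
    (List.destutter_sublist _ _).trans List.filter_sublist
  have hne : ∀ x ∈ s.destutter (· ≠ ·), x ≠ 0 := fun x hx => by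
    simpa using (List.mem_filter.mp ((List.destutter_sublist _ _).subset hx)).2
  have hchain := List.isChain_destutter (· ≠ ·) s
  have hsv : p.signVariations = (s.destutter (· ≠ ·)).length - 1 := rfl
  rw [Polynomial.coeffList, List.map_map] at hsub
  obtain ⟨l, hl, hls⟩ := List.sublist_map_iff.mp hsub
  rw [hls] at hchain hne hsv
  refine ⟨l, by simpa using hsv, ?_, ?_, ?_⟩
  · refine List.Pairwise.sublist hl ?_
    rw [List.pairwise_reverse]
    exact List.pairwise_lt_range
  · intro i hi
    have h := hl.subset hi
    rw [List.mem_reverse, List.mem_range] at h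
    rcases eq_or_ne p 0 with rfl | hp
    · simp at h
    · rw [Polynomial.withBotSucc_degree_eq_natDegree_add_one hp] at h
      omega
  · rw [List.isChain_map] at hchain
    rw [List.isChain_iff_getElem] at hchain ⊢
    intro j hj
    have h := hchain j hj
    have h₁ := hne _ (List.mem_map_of_mem (List.getElem_mem (Nat.lt_of_succ_lt hj)))
    have h₂ := hne _ (List.mem_map_of_mem (List.getElem_mem hj))
    simp only [Function.comp_apply] at h h₁ h₂
    rcases lt_or_gt_of_ne (sign_ne_zero.mp h₁) with h₁ | h₁ <;>
      rcases lt_or_gt_of_ne (sign_ne_zero.mp h₂) with h₂ | h₂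
    · simp [sign_neg h₁, sign_neg h₂] at h
    · exact mul_neg_of_neg_of_pos h₁ h₂
    · exact mul_neg_of_pos_of_neg h₁ h₂
    · simp [sign_pos h₁, sign_pos h₂] at h

/-- A decreasing list of indices along which `a` alternates in sign yields interior zeros of the
piecewise linear interpolant. -/
theorem length_sub_one_le_ncard_plInterp_zeros {n : ℕ} {a : ℕ → ℝ} {l : List ℕ}
    (hl : l.Pairwise (· > ·)) (hn : ∀ i ∈ l, i ≤ n) (hc : l.IsChain fun i k => a i * a k < 0)
    (hfin : {t ∈ Ioo (0 : ℝ) 1 | plInterp a n t = 0}.Finite) :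
    l.length - 1 ≤ {t ∈ Ioo (0 : ℝ) 1 | plInterp a n t = 0}.ncard := by
  rw [List.isChain_iff_getElem] at hc
  rw [List.pairwise_iff_getElem] at hl
  have key : ∀ j : Fin (l.length - 1), ∃ z ∈ Ioo ((l[j.1 + 1] : ℝ) / n) (l[j.1] / n),
      plInterp a n z = 0 := fun j => by
    have hlt := hl j (j + 1) (by omega) (by omega) (by omega)
    have hle := hn _ (List.getElem_mem (show j.1 < l.length by omega))
    exact exists_plInterp_eq_zero_of_mul_neg (by omega) hlt (hc j (by omega))
  choose z hz hz0 using key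
  have hanti : StrictAnti z := fun i j hij => by
    have hle : l[j.1] ≤ l[i.1 + 1] := by
      rcases (Nat.succ_le_of_lt hij : i.1 + 1 ≤ j.1).eq_or_lt with h | h
      · exact (getElem_congr_idx h.symm).le
      · exact (hl _ _ (by omega) (by omega) h).le
    calc z j < l[j.1] / n := (hz j).2
      _ ≤ l[i.1 + 1] / n := by gcongr
      _ < z i := (hz i).1
  have hmem : ∀ j, z j ∈ {t ∈ Ioo (0 : ℝ) 1 | plInterp a n t = 0} := fun j => by
    refine ⟨⟨lt_of_le_of_lt (by positivity) (hz j).1, (hz j).2.trans_le ?_⟩, hz0 j⟩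
    refine div_le_one_of_le₀ ?_ n.cast_nonneg
    exact_mod_cast hn _ (List.getElem_mem _)
  have hcard : (range z).ncard = l.length - 1 := by
    rw [← image_univ, ncard_image_of_injective _ hanti.injective, ncard_univ, Nat.card_fin]
  rw [← hcard]
  exact ncard_le_ncard (range_subset_iff.mpr hmem) hfin

/-- The substitution `x = t / (1 - t)` turns a Bernstein sum into an ordinary polynomial. -/
theorem bernsteinSum_eq_mul_eval (a : ℕ → ℝ) (n : ℕ) {t : ℝ} (ht : t ≠ 1) :
    bernsteinSum a n t = (1 - t) ^ n *
      (∑ i ∈ Finset.range (n + 1), Polynomial.monomial i (n.choose i * a i)).eval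
        (t / (1 - t)) := by
  have h : 1 - t ≠ 0 := sub_ne_zero.mpr ht.symm
  rw [Polynomial.eval_finsetSum, Finset.mul_sum]
  refine Finset.sum_congr rfl fun i hi => ?_
  obtain ⟨k, rfl⟩ := Nat.exists_eq_add_of_le (Nat.lt_succ_iff.mp (Finset.mem_range.mp hi))
  rw [Polynomial.eval_monomial, Nat.add_sub_cancel_left, pow_add, div_pow]
  field_simp

theorem bernsteinSum_zeros_finite_and_ncard_le {n : ℕ} {a : ℕ → ℝ} {p : Polynomial ℝ}
    (hp : p = ∑ i ∈ Finset.range (n + 1), Polynomial.monomial i (n.choose i * a i))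
    (hp0 : p ≠ 0) :
    {t ∈ Ioo (0 : ℝ) 1 | bernsteinSum a n t = 0}.Finite ∧
      {t ∈ Ioo (0 : ℝ) 1 | bernsteinSum a n t = 0}.ncard ≤ p.signVariations := by
  set R := (p.roots.filter (0 < ·)).toFinset with hR
  have hmaps : MapsTo (fun t : ℝ => t / (1 - t)) {t ∈ Ioo (0 : ℝ) 1 | bernsteinSum a n t = 0}
      R := fun t ⟨ht, h⟩ => by
    have h1 : 0 < 1 - t := sub_pos.mpr ht.2
    rw [bernsteinSum_eq_mul_eval a n ht.2.ne, ← hp, mul_eq_zero,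
      or_iff_right (pow_ne_zero _ h1.ne')] at h
    simp only [hR, Multiset.toFinset_filter, Finset.coe_filter, Multiset.mem_toFinset,
      mem_ofPred_eq, Polynomial.mem_roots hp0]
    exact ⟨h, div_pos ht.1 h1⟩
  have hinj : InjOn (fun t : ℝ => t / (1 - t)) {t ∈ Ioo (0 : ℝ) 1 | bernsteinSum a n t = 0} :=
    fun s ⟨hs, _⟩ t ⟨ht, _⟩ h => by
      have h1 : 1 - s ≠ 0 := (sub_pos.mpr hs.2).ne'
      have h2 : 1 - t ≠ 0 := (sub_pos.mpr ht.2).ne'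
      have h3 := (div_eq_div_iff h1 h2).mp h
      linarith
  refine ⟨Finite.of_injOn hmaps hinj R.finite_toSet, ?_⟩
  calc _ ≤ (R : Set ℝ).ncard := ncard_le_ncard_of_injOn _ hmaps hinj R.finite_toSet
    _ = R.card := ncard_coe_finset R
    _ ≤ (p.roots.filter (0 < ·)).card := Multiset.toFinset_card_le _
    _ = p.roots.countP (0 < ·) := (Multiset.countP_eq_card_filter _ _).symm
    _ ≤ p.signVariations := p.roots_countP_pos_le_signVariations

theorem setOf_mem_Icc_eq_union (f : ℝ → ℝ) :
    {t ∈ Icc (0 : ℝ) 1 | f t = 0} =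
      {t ∈ Ioo (0 : ℝ) 1 | f t = 0} ∪ {t ∈ ({0, 1} : Set ℝ) | f t = 0} := by
  rw [← Ioo_union_both zero_le_one]
  exact sep_union

theorem bernsteinSum_variation_diminishing (n : ℕ) (a : ℕ → ℝ)
    (hfin : {t ∈ Icc (0 : ℝ) 1 | plInterp a n t = 0}.Finite) :
    {t ∈ Icc (0 : ℝ) 1 | bernsteinSum a n t = 0}.Finite ∧
      {t ∈ Icc (0 : ℝ) 1 | bernsteinSum a n t = 0}.ncard ≤
        {t ∈ Icc (0 : ℝ) 1 | plInterp a n t = 0}.ncard := by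
  set p : Polynomial ℝ :=
    ∑ i ∈ Finset.range (n + 1), Polynomial.monomial i (n.choose i * a i) with hp
  have hcoeff : ∀ i, p.coeff i = n.choose i * a i := fun i => by
    simp only [hp, Polynomial.finsetSum_coeff, Polynomial.coeff_monomial, Finset.sum_ite_eq',
      Finset.mem_range]
    split_ifs with h
    · rfl
    · rw [Nat.choose_eq_zero_of_lt (by omega)]; simp
  have hdeg : p.natDegree ≤ n := Polynomial.natDegree_le_iff_coeff_eq_zero.mpr fun i hi => by
    rw [hcoeff, Nat.choose_eq_zero_of_lt hi]; simp
  have hp0 : p ≠ 0 := by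
    intro h0
    have ha : ∀ i ≤ n, a i = 0 := fun i hi => by
      have h := hcoeff i
      rw [h0, Polynomial.coeff_zero, eq_comm, mul_eq_zero] at h
      exact h.resolve_left (by exact_mod_cast (Nat.choose_pos hi).ne')
    refine Icc_infinite (zero_lt_one (α := ℝ)) (hfin.subset fun t ht => ⟨ht, ?_⟩)
    have hle : ⌊t * n⌋₊ ≤ n :=
      Nat.floor_le_of_le (mul_le_of_le_one_left n.cast_nonneg ht.2)
    rcases hle.eq_or_lt with h | h
    · have hge : (n : ℝ) ≤ t * n := by
        simpa [h] using Nat.floor_le (mul_nonneg ht.1 n.cast_nonneg)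
      have heq := hge.antisymm (mul_le_of_le_one_left n.cast_nonneg ht.2)
      rw [plInterp, ← heq]
      simp [ha n le_rfl]
    · simp [plInterp, ha _ hle, ha _ h]
  obtain ⟨l, hlen, hpw, hln, hch⟩ := exists_list_coeff_alternating p
  have hch' : l.IsChain fun i k => a i * a k < 0 := hch.imp fun i k h => by
    rw [hcoeff, hcoeff, mul_mul_mul_comm] at h
    exact neg_of_mul_neg_right h (by positivity)
  rw [setOf_mem_Icc_eq_union] at hfin
  obtain ⟨hBfin, hB⟩ := bernsteinSum_zeros_finite_and_ncard_le hp hp0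
  have hL := length_sub_one_le_ncard_plInterp_zeros hpw (fun i hi => (hln i hi).trans hdeg) hch'
    (hfin.subset subset_union_left)
  have hends : {t ∈ ({0, 1} : Set ℝ) | bernsteinSum a n t = 0} =
      {t ∈ ({0, 1} : Set ℝ) | plInterp a n t = 0} := by
    ext t
    refine and_congr_right fun ht => ?_
    rcases ht with rfl | rfl
    · rw [bernsteinSum_zero, plInterp_zero]
    · rw [bernsteinSum_one, plInterp_one]
  have hefin := hfin.subset subset_union_right
  rw [setOf_mem_Icc_eq_union, setOf_mem_Icc_eq_union, hends]
  refine ⟨hBfin.union hefin, (ncard_union_le _ _).trans ?_⟩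
  rw [ncard_union_eq _ (hfin.subset subset_union_left) hefin]
  · omega
  · rw [disjoint_left]
    rintro t ⟨ht, _⟩ ⟨rfl | rfl, _⟩
    · exact lt_irrefl _ ht.1
    · exact lt_irrefl _ ht.2

/-- Variation diminishing property. For any affine plane
`{x : ⟨ν, x⟩ = c}` (with `ν ≠ 0`), if the parameter set where the control
polygon meets the plane is finite, then the parameter set where the Bézier
curve meets the plane is finite and has at most as many elements. -/
theorem bezier_variation_diminishing (n : ℕ) (P : ℕ → V3) (ν : V3) (hν : ν ≠ 0) (c : ℝ)
    (hfin : {t ∈ Icc (0 : ℝ) 1 | ∑ j, ν j * plPath P n t j = c}.Finite) :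
    {t ∈ Icc (0 : ℝ) 1 | ∑ j, ν j * bezier n P t j = c}.Finite ∧
      {t ∈ Icc (0 : ℝ) 1 | ∑ j, ν j * bezier n P t j = c}.ncard ≤
        {t ∈ Icc (0 : ℝ) 1 | ∑ j, ν j * plPath P n t j = c}.ncard := by
  simp only [sum_mul_plPath n P ν c, sum_mul_bezier n P ν c, add_eq_right] at hfin ⊢
  exact bernsteinSum_variation_diminishing n _ hfin
end
end

section
/- Let K_{0,4,0}, …, K_{0,4,15} be the 16 sub-control polygons (each a piecewise linear curve on 7 points) produced by 4 iterations of de Casteljau subdivision at parameter 1/2 applied to K_0, indexed cyclically in order. Then for cyclically consecutive indices i and i+1 (mod 16), the convex hulls of the point sets of K_{0,4,i} and K_{0,4,i+1} intersect exactly in the single shared endpoint, and for all other pairs of distinct indices the convex hulls are disjoint. -/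
open Set Real

noncomputable section

/-- The `i`-th of the 16 sub-control polygons produced by 4 iterations of
de Casteljau subdivision at parameter 1/2 applied to K₀. -/
def polyK04 (i : ℕ) : ℕ → V3 := (subPolys 6 4 (vertsOf K0verts)).getD i fun _ => 0

/-- The convex hull of the point set of a degree-6 control polygon. -/
def chull6 (Q : ℕ → V3) : Set V3 := convexHull ℝ (Q '' {i : ℕ | i ≤ 6})

/-- If a linear functional is smaller on `s` than on `t`, then the convex hulls of `s` and `t`
are disjoint. -/
lemma disjoint_convexHull_of_lt {E : Type*} [AddCommGroup E] [Module ℝ E] (f : E →ₗ[ℝ] ℝ)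
    {s t : Set E} (h : ∀ a ∈ s, ∀ b ∈ t, f a < f b) :
    Disjoint (convexHull ℝ s) (convexHull ℝ t) := by
  have hs (b : E) (hb : b ∈ t) : convexHull ℝ s ⊆ {x | f x < f b} :=
    convexHull_min (fun a ha => h a ha b hb) (convex_halfSpace_lt f.isLinear _)
  have ht (x : E) (hx : x ∈ convexHull ℝ s) : convexHull ℝ t ⊆ {y | f x < f y} :=
    convexHull_min (fun b hb => hs b hb hx) (convex_halfSpace_gt f.isLinear _)
  exact Set.disjoint_left.2 fun x hx hx' => lt_irrefl (f x) (ht x hx hx')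

/-- An open half-space together with one point of its boundary is convex. -/
lemma convex_insert_halfSpace_lt {E : Type*} [AddCommGroup E] [Module ℝ E] (f : E →ₗ[ℝ] ℝ)
    (p : E) : Convex ℝ {x | x = p ∨ f x < f p} := by
  rw [convex_iff_forall_pos]
  rintro x hx y hy a b ha hb hab
  obtain rfl : b = 1 - a := by linarith
  simp only [mem_ofPred_eq, map_add, map_smul, smul_eq_mul] at *
  rcases hx with rfl | hx <;> rcases hy with rfl | hy
  · left
    rw [← add_smul, hab, one_smul]
  all_goals
    right
    nlinarith

/-- If a linear functional is maximal on `s` only at `p` and minimal on `t` only at `p`, then the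
convex hulls of `s` and `t` meet exactly in `p`. -/
lemma convexHull_inter_eq_singleton {E : Type*} [AddCommGroup E] [Module ℝ E] (f : E →ₗ[ℝ] ℝ)
    {s t : Set E} {p : E} (hps : p ∈ s) (hpt : p ∈ t)
    (hs : ∀ a ∈ s, a = p ∨ f a < f p) (ht : ∀ b ∈ t, b = p ∨ f p < f b) :
    convexHull ℝ s ∩ convexHull ℝ t = {p} := by
  have hs' : convexHull ℝ s ⊆ {x | x = p ∨ f x < f p} :=
    convexHull_min hs (convex_insert_halfSpace_lt f p)
  have ht' : convexHull ℝ t ⊆ {x | x = p ∨ (-f) x < (-f) p} :=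
    convexHull_min (by simpa [subset_def] using ht) (convex_insert_halfSpace_lt (-f) p)
  refine subset_antisymm (fun x hx => ?_) ?_
  · rcases hs' hx.1 with h | h
    · exact h
    · rcases ht' hx.2 with h' | h'
      · exact h'
      · simp only [LinearMap.neg_apply, neg_lt_neg_iff] at h'
        exact absurd h h'.not_gt
  · rintro _ rfl
    exact ⟨subset_convexHull ℝ s hps, subset_convexHull ℝ t hpt⟩

/-- The point of ℝ³ with the given integer coordinates. -/
def intPt : ℤ × ℤ × ℤ →+ V3 where
  toFun z := pt z.1 z.2.1 z.2.2
  map_zero' := by ext i; fin_cases i <;> simp [pt]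
  map_add' a b := by ext i; fin_cases i <;> simp [pt]

/-- The dot product of integer vectors. -/
def intDot (n z : ℤ × ℤ × ℤ) : ℤ := n.1 * z.1 + n.2.1 * z.2.1 + n.2.2 * z.2.2

/-- The linear functional on ℝ³ given by the dot product with an integer vector. -/
def dotMap (n : ℤ × ℤ × ℤ) : V3 →ₗ[ℝ] ℝ :=
  (n.1 : ℝ) • LinearMap.proj 0 + (n.2.1 : ℝ) • LinearMap.proj 1 + (n.2.2 : ℝ) • LinearMap.proj 2

lemma dotMap_intPt (n z : ℤ × ℤ × ℤ) : dotMap n (intPt z) = intDot n z := by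
  simp [dotMap, intPt, intDot, pt]

/-- The `k`-th row of the de Casteljau scheme of `l`, with midpoints replaced by sums. -/
def intRow (l : List (ℤ × ℤ × ℤ)) : ℕ → List (ℤ × ℤ × ℤ)
  | 0 => l
  | k + 1 => List.zipWith (· + ·) (intRow l k) (intRow l k).tail

/-- `2 ^ n` times the left half of a de Casteljau subdivision step. -/
def intLeft (n : ℕ) (l : List (ℤ × ℤ × ℤ)) : List (ℤ × ℤ × ℤ) :=
  (List.range (n + 1)).map fun i => (2 : ℤ) ^ (n - i) • (intRow l i).getD 0 0

/-- `2 ^ n` times the right half of a de Casteljau subdivision step. -/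
def intRight (n : ℕ) (l : List (ℤ × ℤ × ℤ)) : List (ℤ × ℤ × ℤ) :=
  (List.range (n + 1)).map fun i => (2 : ℤ) ^ i • (intRow l (n - i)).getD i 0

/-- `2 ^ (n * k)` times the polygons produced by `k` de Casteljau subdivisions. -/
def intSubPolys (n : ℕ) : ℕ → List (ℤ × ℤ × ℤ) → List (List (ℤ × ℤ × ℤ))
  | 0, l => [l]
  | k + 1, l => intSubPolys n k (intLeft n l) ++ intSubPolys n k (intRight n l)

/-- The list `l` of integer points represents `c` times the degree-`n` control polygon `P`. -/
def Represents (n : ℕ) (c : ℝ) (P : ℕ → V3) (l : List (ℤ × ℤ × ℤ)) : Prop :=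
  l.length = n + 1 ∧ ∀ i ≤ n, intPt (l.getD i 0) = c • P i

lemma length_intRow (l : List (ℤ × ℤ × ℤ)) (k : ℕ) : (intRow l k).length = l.length - k := by
  induction k with
  | zero => simp [intRow]
  | succ k ih => simp [intRow, ih]; omega

lemma Represents.intPt_intRow {n : ℕ} {c : ℝ} {P : ℕ → V3} {l : List (ℤ × ℤ × ℤ)}
    (h : Represents n c P l) (k i : ℕ) (hki : k + i ≤ n) :
    intPt ((intRow l k).getD i 0) = (2 ^ k * c) • dcQ P k i := by
  induction k generalizing i with
  | zero => simpa [intRow, dcQ] using h.2 i (by omega)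
  | succ k ih =>
    have hlen := length_intRow l k
    rw [h.1] at hlen
    have hsum : (intRow l (k + 1)).getD i 0
        = (intRow l k).getD i 0 + (intRow l k).getD (i + 1) 0 := by
      have h₀ : i < (intRow l k).length := by omega
      have h₁ : i + 1 < (intRow l k).length := by omega
      have h₂ : i < (intRow l (k + 1)).length := by rw [length_intRow, h.1]; omega
      rw [List.getD_eq_getElem _ _ h₀, List.getD_eq_getElem _ _ h₁, List.getD_eq_getElem _ _ h₂]
      simp [intRow]
    rw [hsum, map_add, ih i (by omega), ih (i + 1) (by omega), dcQ, smul_smul, ← smul_add]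
    congr 1
    ring

lemma Represents.left {n : ℕ} {c : ℝ} {P : ℕ → V3} {l : List (ℤ × ℤ × ℤ)}
    (h : Represents n c P l) : Represents n (2 ^ n * c) (dcLeft P) (intLeft n l) := by
  refine ⟨by simp [intLeft], fun i hi => ?_⟩
  rw [intLeft, List.getD_eq_getElem _ _ (by simp; omega), List.getElem_map, List.getElem_range,
    map_zsmul, h.intPt_intRow i 0 (by omega), dcLeft, ← Int.cast_smul_eq_zsmul ℝ, smul_smul]
  congr 1
  push_cast
  rw [← mul_assoc, ← pow_add, Nat.sub_add_cancel hi]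

lemma Represents.right {n : ℕ} {c : ℝ} {P : ℕ → V3} {l : List (ℤ × ℤ × ℤ)}
    (h : Represents n c P l) : Represents n (2 ^ n * c) (dcRight n P) (intRight n l) := by
  refine ⟨by simp [intRight], fun i hi => ?_⟩
  rw [intRight, List.getD_eq_getElem _ _ (by simp; omega), List.getElem_map, List.getElem_range,
    map_zsmul, h.intPt_intRow (n - i) i (by omega), dcRight, ← Int.cast_smul_eq_zsmul ℝ,
    smul_smul]
  congr 1
  push_cast
  rw [← mul_assoc, ← pow_add, Nat.add_sub_cancel' hi]

lemma Represents.subPolys {n : ℕ} {c : ℝ} {P : ℕ → V3} {l : List (ℤ × ℤ × ℤ)} (k : ℕ)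
    (h : Represents n c P l) :
    List.Forall₂ (Represents n (2 ^ (n * k) * c)) (subPolys n k P) (intSubPolys n k l) := by
  induction k generalizing P l c with
  | zero => simpa [_root_.subPolys, intSubPolys] using h
  | succ k ih =>
    have hc : (2 : ℝ) ^ (n * (k + 1)) * c = 2 ^ (n * k) * (2 ^ n * c) := by ring
    rw [hc]
    exact List.rel_append (ih h.left) (ih h.right)

lemma Represents.image_eq {n : ℕ} {c : ℝ} {P : ℕ → V3} {l : List (ℤ × ℤ × ℤ)}
    (h : Represents n c P l) (hc : c ≠ 0) :
    P '' {i | i ≤ n} = (fun z => c⁻¹ • intPt z) '' {z | z ∈ l} := by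
  have hP (i : ℕ) (hi : i ≤ n) : c⁻¹ • intPt (l.getD i 0) = P i := by
    rw [h.2 i hi, inv_smul_smul₀ hc]
  ext x
  constructor
  · rintro ⟨i, hi, rfl⟩
    refine ⟨l.getD i 0, ?_, hP i hi⟩
    rw [List.getD_eq_getElem _ _ (by rw [h.1]; exact Nat.lt_succ_of_le hi)]
    exact List.getElem_mem _
  · rintro ⟨z, hz, rfl⟩
    obtain ⟨i, hi, rfl⟩ := List.getElem_of_mem hz
    have hi' : i ≤ n := by rw [h.1] at hi; omega
    exact ⟨i, hi', by rw [← hP i hi', List.getD_eq_getElem _ _ hi]⟩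

/-- The integer vertices of K₀, as a degree-6 control polygon. -/
def intK0 : List (ℤ × ℤ × ℤ) :=
  [(0, 9, 20), (-15, -95, -50), (40, 80, -20), (-10, -60, 58), (-60, 30, 20), (40, -60, -60),
    (0, 9, 20)]

lemma represents_intK0 : Represents 6 1 (vertsOf K0verts) intK0 := by
  refine ⟨rfl, fun i hi => ?_⟩
  interval_cases i <;> simp [intK0, intPt, vertsOf, K0verts]

/-- `2 ^ 24` times the `i`-th of the 16 sub-control polygons of K₀. -/
def intPolyK04 (i : ℕ) : List (ℤ × ℤ × ℤ) := (intSubPolys 6 4 intK0).getD i []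

lemma represents_intPolyK04 (i : Fin 16) :
    Represents 6 (2 ^ 24) (polyK04 i.val) (intPolyK04 i.val) := by
  have h := represents_intK0.subPolys 4
  have hlen : (intSubPolys 6 4 intK0).length = 16 := by simp [intSubPolys]
  have hi : i.val < (intSubPolys 6 4 intK0).length := by rw [hlen]; exact i.isLt
  have hi' : i.val < (subPolys 6 4 (vertsOf K0verts)).length := by rw [h.length_eq]; exact hi
  rw [polyK04, intPolyK04, List.getD_eq_getElem _ _ hi', List.getD_eq_getElem _ _ hi]
  simpa using h.get hi' hi

/-- Normals of planes separating the sub-control polygons. -/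
def separatingNormals : List (ℤ × ℤ × ℤ) := [(-2, 1, -1), (0, 5, -2), (-4, 3, -4)]

lemma exists_normal_consecutive (i : Fin 16) : ∃ n ∈ separatingNormals,
    (intPolyK04 i.val).getD 6 0 ∈ intPolyK04 (i + 1).val ∧
    (∀ a ∈ intPolyK04 i.val, a = (intPolyK04 i.val).getD 6 0 ∨
      intDot n a < intDot n ((intPolyK04 i.val).getD 6 0)) ∧
    ∀ b ∈ intPolyK04 (i + 1).val, b = (intPolyK04 i.val).getD 6 0 ∨
      intDot n ((intPolyK04 i.val).getD 6 0) < intDot n b := by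
  revert i
  decide +kernel

lemma exists_normal_separated (i j : Fin 16) (hij : i ≠ j) (hij' : i + 1 ≠ j) (hji : j + 1 ≠ i) :
    ∃ n ∈ separatingNormals,
      (∀ a ∈ intPolyK04 i.val, ∀ b ∈ intPolyK04 j.val, intDot n a < intDot n b) ∨
      ∀ b ∈ intPolyK04 j.val, ∀ a ∈ intPolyK04 i.val, intDot n b < intDot n a := by
  revert i j
  decide +kernel

lemma dotMap_smul_intPt_lt {c : ℝ} (hc : 0 < c) {n a b : ℤ × ℤ × ℤ}
    (h : intDot n a < intDot n b) :
    dotMap n (c⁻¹ • intPt a) < dotMap n (c⁻¹ • intPt b) := by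
  simp only [map_smul, dotMap_intPt, smul_eq_mul]
  gcongr

/-- cyclically consecutive sub-control polygons of K₀,₄ have
convex hulls meeting exactly in the shared endpoint, and all other pairs of
convex hulls are disjoint. -/
theorem K04_hulls_pairwise_disjoint :
    (∀ i : Fin 16,
      chull6 (polyK04 i.val) ∩ chull6 (polyK04 (i + 1).val) = {polyK04 i.val 6}) ∧
    (∀ i j : Fin 16, i ≠ j → i + 1 ≠ j → j + 1 ≠ i →
      Disjoint (chull6 (polyK04 i.val)) (chull6 (polyK04 j.val))) := by
  have hc : (0 : ℝ) < 2 ^ 24 := by positivity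
  refine ⟨fun i => ?_, fun i j hij hij' hji => ?_⟩
  · obtain ⟨n, -, hmem, hi, hj⟩ := exists_normal_consecutive i
    have hrep := represents_intPolyK04 i
    have hp : polyK04 i.val 6 = (2 ^ 24 : ℝ)⁻¹ • intPt ((intPolyK04 i.val).getD 6 0) := by
      rw [hrep.2 6 le_rfl, inv_smul_smul₀ hc.ne']
    refine convexHull_inter_eq_singleton (dotMap n) ⟨6, le_refl 6, rfl⟩ ?_ ?_ ?_
    · rw [(represents_intPolyK04 (i + 1)).image_eq hc.ne', hp]
      exact ⟨_, hmem, rfl⟩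
    · rw [hrep.image_eq hc.ne', hp]
      rintro _ ⟨a, ha, rfl⟩
      exact (hi a ha).imp (fun h => by rw [h]) (dotMap_smul_intPt_lt hc)
    · rw [(represents_intPolyK04 (i + 1)).image_eq hc.ne', hp]
      rintro _ ⟨b, hb, rfl⟩
      exact (hj b hb).imp (fun h => by rw [h]) (dotMap_smul_intPt_lt hc)
  · obtain ⟨n, -, h⟩ := exists_normal_separated i j hij hij' hji
    rw [chull6, chull6, (represents_intPolyK04 i).image_eq hc.ne',
      (represents_intPolyK04 j).image_eq hc.ne']
    rcases h with h | h
    · refine disjoint_convexHull_of_lt (dotMap n) ?_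
      rintro _ ⟨a, ha, rfl⟩ _ ⟨b, hb, rfl⟩
      exact dotMap_smul_intPt_lt hc (h a ha b hb)
    · refine (disjoint_convexHull_of_lt (dotMap n) ?_).symm
      rintro _ ⟨b, hb, rfl⟩ _ ⟨a, ha, rfl⟩
      exact dotMap_smul_intPt_lt hc (h b hb a ha)
end
end

section
/- Each of the 16 sub-control polygons produced by 4 iterations of de Casteljau subdivision at parameter 1/2 applied to K_0 has control points that are strictly monotone in at least one coordinate: for each sub-control polygon with points P_0,…,P_6 there exists a coordinate index j ∈ {1,2,3} such that either (P_i)_j < (P_{i+1})_j for all i = 0,…,5 or (P_i)_j > (P_{i+1})_j for all i = 0,…,5; in particular, each sub-control polygon is a simple (injective) piecewise linear arc. -/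
open Set Real

noncomputable section

theorem plPath_apply_s19 (P : ℕ → V3) (m : ℕ) (t : ℝ) (j : Fin 3) :
    plPath P m t j =
      P ⌊t * m⌋₊ j + (t * m - ⌊t * m⌋₊) * (P (⌊t * m⌋₊ + 1) j - P ⌊t * m⌋₊ j) := by
  have h : (⌊t * m⌋.toNat : ℕ) = ⌊t * m⌋₊ := Int.floor_toNat _
  simp only [plPath, h, Pi.add_apply, Pi.smul_apply, smul_eq_mul]
  ring

theorem plPath_neg (P : ℕ → V3) (m : ℕ) (t : ℝ) :
    plPath (fun i => -P i) m t = -plPath P m t := by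
  simp only [plPath, smul_neg]
  abel

/-- A piecewise linear path whose vertices increase strictly in coordinate `j` is strictly
increasing in that coordinate. -/
theorem plPath_strictMonoOn {P : ℕ → V3} {m : ℕ} {j : Fin 3} (hm : 0 < m)
    (h : ∀ i < m, P i j < P (i + 1) j) :
    StrictMonoOn (fun t => plPath P m t j) (Icc (0 : ℝ) 1) := by
  intro s hs t ht hst
  have hm0 : (0 : ℝ) ≤ m := m.cast_nonneg
  have hm' : (0 : ℝ) < m := by exact_mod_cast hm
  have hlt : s * m < t * m := mul_lt_mul_of_pos_right hst hm'
  have hs0 : 0 ≤ s * m := mul_nonneg hs.1 hm0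
  have ht0 : 0 ≤ t * m := mul_nonneg ht.1 hm0
  have htm : t * m ≤ m := mul_le_of_le_one_left hm0 ht.2
  have hsm : ⌊s * m⌋₊ < m := (Nat.floor_lt hs0).2 (hlt.trans_le htm)
  have hle : ⌊s * m⌋₊ ≤ ⌊t * m⌋₊ := Nat.floor_mono hlt.le
  have hsl : (⌊s * m⌋₊ : ℝ) ≤ s * m := Nat.floor_le hs0
  have hsu : s * m < ⌊s * m⌋₊ + 1 := Nat.lt_floor_add_one _
  have htl : (⌊t * m⌋₊ : ℝ) ≤ t * m := Nat.floor_le ht0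
  have htk : ⌊t * m⌋₊ ≤ m := Nat.floor_le_of_le htm
  simp only [plPath_apply_s19]
  generalize ⌊s * m⌋₊ = a at *
  generalize ⌊t * m⌋₊ = b at *
  have ha := h a hsm
  rcases hle.eq_or_lt with rfl | hab
  · nlinarith
  · have hmono : ∀ k, a + 1 ≤ k → k ≤ m → P (a + 1) j ≤ P k j := by
      intro k hk
      induction k, hk using Nat.le_induction with
      | base => exact fun _ => le_rfl
      | succ k _ ih => exact fun hkm => (ih (by omega)).trans (h k (by omega)).le
    have hright : 0 ≤ (t * m - b) * (P (b + 1) j - P b j) := by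
      rcases htk.eq_or_lt with rfl | hbm
      · simp [le_antisymm htm htl]
      · exact mul_nonneg (sub_nonneg.2 htl) (sub_nonneg.2 (h b hbm).le)
    have := hmono b hab htk
    nlinarith

theorem plPath_injOn {P : ℕ → V3} {m : ℕ} {j : Fin 3} (hm : 0 < m)
    (h : (∀ i < m, P i j < P (i + 1) j) ∨ (∀ i < m, P (i + 1) j < P i j)) :
    InjOn (plPath P m) (Icc (0 : ℝ) 1) := by
  rcases h with h | h
  · exact fun s hs t ht hst => (plPath_strictMonoOn hm h).injOn hs ht (congrFun hst j)
  · have h' : ∀ i < m, (fun i => -P i) i j < (fun i => -P i) (i + 1) j :=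
      fun i hi => neg_lt_neg (h i hi)
    refine fun s hs t ht hst => (plPath_strictMonoOn hm h').injOn hs ht ?_
    simp only [plPath_neg, hst]

/-- One half of the subdivision of a degree-`n` control polygon: the right one if `b`, and the
left one otherwise. -/
def dcHalf (n : ℕ) (P : ℕ → V3) (b : Bool) : ℕ → V3 :=
  bif b then dcRight n P else dcLeft P

theorem exists_foldl_dcHalf_of_mem_subPolys {n k : ℕ} {P Q : ℕ → V3}
    (hQ : Q ∈ subPolys n k P) : ∃ w : List Bool, w.length = k ∧ Q = w.foldl (dcHalf n) P := by
  induction k generalizing P with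
  | zero => exact ⟨[], rfl, by simpa [subPolys] using hQ⟩
  | succ k ih =>
    rcases List.mem_append.1 hQ with h | h
    · obtain ⟨w, hw, rfl⟩ := ih h
      exact ⟨false :: w, by simp [hw], rfl⟩
    · obtain ⟨w, hw, rfl⟩ := ih h
      exact ⟨true :: w, by simp [hw], rfl⟩

/-- One coordinate of `dcHalf 6`, scaled by `2 ^ 6` so that it stays within the integers. -/
def intHalf (p : ℕ → ℤ) (b : Bool) (i : ℕ) : ℤ :=
  (bif b then
    [p 0 + 6 * p 1 + 15 * p 2 + 20 * p 3 + 15 * p 4 + 6 * p 5 + p 6,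
      2 * (p 1 + 5 * p 2 + 10 * p 3 + 10 * p 4 + 5 * p 5 + p 6),
      4 * (p 2 + 4 * p 3 + 6 * p 4 + 4 * p 5 + p 6),
      8 * (p 3 + 3 * p 4 + 3 * p 5 + p 6),
      16 * (p 4 + 2 * p 5 + p 6),
      32 * (p 5 + p 6),
      64 * p 6]
  else
    [64 * p 0,
      32 * (p 0 + p 1),
      16 * (p 0 + 2 * p 1 + p 2),
      8 * (p 0 + 3 * p 1 + 3 * p 2 + p 3),
      4 * (p 0 + 4 * p 1 + 6 * p 2 + 4 * p 3 + p 4),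
      2 * (p 0 + 5 * p 1 + 10 * p 2 + 10 * p 3 + 5 * p 4 + p 5),
      p 0 + 6 * p 1 + 15 * p 2 + 20 * p 3 + 15 * p 4 + 6 * p 5 + p 6]).getD i 0

theorem intHalf_eq {P : ℕ → V3} {j : Fin 3} {p : ℕ → ℤ} {c : ℝ}
    (h : ∀ i ≤ 6, (p i : ℝ) = c * P i j) (b : Bool) :
    ∀ i ≤ 6, (intHalf p b i : ℝ) = 2 ^ 6 * c * dcHalf 6 P b i j := by
  intro i hi
  have h0 := h 0 (by norm_num)
  have h1 := h 1 (by norm_num)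
  have h2 := h 2 (by norm_num)
  have h3 := h 3 (by norm_num)
  have h4 := h 4 (by norm_num)
  have h5 := h 5 (by norm_num)
  have h6 := h 6 (by norm_num)
  cases b <;> interval_cases i <;>
    simp [intHalf, dcHalf, dcLeft, dcRight, dcQ, h0, h1, h2, h3, h4, h5, h6] <;> ring

theorem exists_pos_foldl_intHalf_eq {P : ℕ → V3} {j : Fin 3} {p : ℕ → ℤ} {c : ℝ}
    (hc : 0 < c) (h : ∀ i ≤ 6, (p i : ℝ) = c * P i j) (w : List Bool) :
    ∃ d : ℝ, 0 < d ∧ ∀ i ≤ 6, (w.foldl intHalf p i : ℝ) = d * w.foldl (dcHalf 6) P i j := by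
  induction w generalizing P p c with
  | nil => exact ⟨c, hc, h⟩
  | cons b w ih => exact ih (by positivity) (intHalf_eq h b)

/-- The integer coordinates of the vertices of K₀. -/
def K0coord (j : Fin 3) (i : ℕ) : ℤ :=
  (![[0, -15, 40, -10, -60, 40, 0], [9, -95, 80, -60, 30, -60, 9],
    [20, -50, -20, 58, 20, -60, 20]] j).getD i 0

theorem K0coord_eq (j : Fin 3) : ∀ i ≤ 6, (K0coord j i : ℝ) = 1 * vertsOf K0verts i j := by
  intro i hi
  interval_cases i <;> fin_cases j <;> simp [K0coord, vertsOf, K0verts, pt]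

theorem K0coord_monotone (a b c d : Bool) : ∃ j : Fin 3,
    (∀ i < 6, [a, b, c, d].foldl intHalf (K0coord j) i <
      [a, b, c, d].foldl intHalf (K0coord j) (i + 1)) ∨
    (∀ i < 6, [a, b, c, d].foldl intHalf (K0coord j) (i + 1) <
      [a, b, c, d].foldl intHalf (K0coord j) i) := by
  decide +kernel +revert

/-- each of the 16 sub-control polygons produced by 4 iterations
of de Casteljau subdivision at parameter 1/2 applied to K₀ is strictly monotone
in at least one coordinate; in particular each is a simple (injective) PL arc. -/
theorem K04_subpolygons_monotone_and_simple :
    ∀ Q ∈ subPolys 6 4 (vertsOf K0verts),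
      (∃ j : Fin 3,
        (∀ i < 6, Q i j < Q (i + 1) j) ∨ (∀ i < 6, Q (i + 1) j < Q i j)) ∧
      Set.InjOn (plPath Q 6) (Icc (0 : ℝ) 1) := by
  intro Q hQ
  obtain ⟨w, hw, rfl⟩ := exists_foldl_dcHalf_of_mem_subPolys hQ
  obtain ⟨a, b, c, d, rfl⟩ := List.length_eq_four.1 hw
  obtain ⟨j, hj⟩ := K0coord_monotone a b c d
  obtain ⟨e, he, hcoord⟩ := exists_pos_foldl_intHalf_eq one_pos (K0coord_eq j) [a, b, c, d]
  have hlt : ∀ i ≤ 6, ∀ k ≤ 6, [a, b, c, d].foldl intHalf (K0coord j) i <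
      [a, b, c, d].foldl intHalf (K0coord j) k →
      [a, b, c, d].foldl (dcHalf 6) (vertsOf K0verts) i j <
        [a, b, c, d].foldl (dcHalf 6) (vertsOf K0verts) k j := by
    intro i hi k hk h
    refine lt_of_mul_lt_mul_left ?_ he.le
    rw [← hcoord i hi, ← hcoord k hk]
    exact_mod_cast h
  have hmono := hj.imp
    (fun h i hi => hlt i (by omega) (i + 1) (by omega) (h i hi))
    (fun h i hi => hlt (i + 1) (by omega) i (by omega) (h i hi))
  exact ⟨⟨j, hmono⟩, plPath_injOn (by norm_num) hmono⟩
end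
end
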